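/- arXiv:0710.5142 — 6 statements merged into one kernel-verified Lean document; each statement's English description precedes it below -/
import Mathlib

section
/- The BME polytope for n = 7 has a non-edge: there exist two binary phylogenetic trees T₁ and T₂ on leaf set {1,…,7}, each having exactly three cherries, with distinct BME vectors v_{T₁} ≠ v_{T₂}, such that for every dissimilarity map D ∈ ℝ^{21}, if v_{T₁}·D = v_{T₂}·D ≤ v_T·D for all binary trees T on {1,…,7}, then there is a binary tree T₃ with v_{T₃} ∉ {v_{T₁}, v_{T₂}} and v_{T₃}·D = v_{T₁}·D. That is, T₁ and T₂ can never be the only co-optimal BME trees. -/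
/-- A phylogenetic tree on leaf set `{1,…,n}`: a finite tree (connected acyclic simple
graph) whose degree-1 vertices (leaves) are labeled bijectively by `Fin n` and all of
whose non-leaf (internal) vertices have degree at least 3.  Degrees are expressed via
`(G.neighborSet v).ncard`. -/
structure PhyloTree (n : ℕ) where
  V : Type
  fin : Fintype V
  G : SimpleGraph V
  tree : G.IsTree
  leaf : Fin n → V
  inj : Function.Injective leaf
  leafDeg : ∀ i, (G.neighborSet (leaf i)).ncard = 1
  leafAll : ∀ v, (G.neighborSet v).ncard = 1 → ∃ i, leaf i = v
  internalDeg : ∀ v, (∀ i, leaf i ≠ v) → 3 ≤ (G.neighborSet v).ncard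

/-- A phylogenetic tree is binary if every internal vertex has degree exactly 3. -/
def PhyloTree.IsBinary {n : ℕ} (T : PhyloTree n) : Prop :=
  ∀ v, (∀ i, T.leaf i ≠ v) → (T.G.neighborSet v).ncard = 3

/-- A phylogenetic tree is the star tree if it has exactly one internal vertex. -/
def PhyloTree.IsStar {n : ℕ} (T : PhyloTree n) : Prop :=
  ∃! v : T.V, ∀ i, T.leaf i ≠ v

open Classical in
/-- The BME coefficient `λ_{ab} = Π_{v ∈ p_{ab}} 1/(deg v - 1)` of a pair of leaves
`a, b`, the product being over the internal vertices on the unique path from `a` to `b`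
(leaves on the path contribute a factor 1). -/
noncomputable def PhyloTree.lam {n : ℕ} (T : PhyloTree n) (a b : Fin n) : ℝ :=
  ((T.tree.existsUnique_path (T.leaf a) (T.leaf b)).choose.support.map
    (fun v => if ∀ i, T.leaf i ≠ v then (((T.G.neighborSet v).ncard : ℝ) - 1)⁻¹ else 1)).prod

/-- The index set of unordered pairs of leaves, encoded as ordered pairs `(a, b)` with
`a < b`; there are `n(n-1)/2` of them. -/
abbrev LeafPairs (n : ℕ) := {p : Fin n × Fin n // p.1 < p.2}

/-- The BME vector `v_T = (λ_{ab}) ∈ ℝ^{n(n-1)/2}` of a phylogenetic tree. -/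
noncomputable def PhyloTree.bmeVec {n : ℕ} (T : PhyloTree n) : LeafPairs n → ℝ :=
  fun p => T.lam p.1.1 p.1.2

/-- The BME polytope: the convex hull of the BME vectors of all phylogenetic trees
on leaf set `{1,…,n}`. -/
noncomputable def bmePolytope (n : ℕ) : Set (LeafPairs n → ℝ) :=
  convexHull ℝ {x | ∃ T : PhyloTree n, T.bmeVec = x}

/-- The number of cherries of a phylogenetic tree: the number of unordered pairs of
leaves adjacent to a common vertex. -/
noncomputable def PhyloTree.cherryCount {n : ℕ} (T : PhyloTree n) : ℕ :=
  Set.ncard {p : Fin n × Fin n |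
    p.1 < p.2 ∧ ∃ v, T.G.Adj (T.leaf p.1) v ∧ T.G.Adj (T.leaf p.2) v}

/-- Parent map of the fixed tree shape, rooted at `7`; positions `0..6` are the leaves. -/
def bmePar : Fin 12 → Fin 12 := ![8, 9, 9, 10, 10, 11, 11, 7, 7, 8, 7, 7]

def bmeDepth : Fin 12 → ℕ := ![2, 3, 3, 2, 2, 2, 2, 0, 1, 2, 1, 1]

/-- The fixed tree shape. -/
def bmeG : SimpleGraph (Fin 12) where
  Adj i j := i ≠ j ∧ (bmePar i = j ∨ bmePar j = i)
  symm := ⟨fun _ _ h => ⟨h.1.symm, h.2.symm⟩⟩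
  loopless := ⟨fun _ h => h.1 rfl⟩

instance : DecidableRel bmeG.Adj := fun i j =>
  inferInstanceAs (Decidable (i ≠ j ∧ (bmePar i = j ∨ bmePar j = i)))

/-- Vertex list of the path between two vertices. -/
def bmePath : ℕ → Fin 12 → Fin 12 → List (Fin 12)
  | 0, a, _ => [a]
  | k + 1, a, b =>
    if a = b then [a]
    else if bmeDepth b ≤ bmeDepth a then a :: bmePath k (bmePar a) b
    else bmePath k a (bmePar b) ++ [b]

lemma bme_walk_of_chain {V : Type} {G : SimpleGraph V} (l : List V) :
    ∀ (u w : V), List.IsChain G.Adj (u :: l) → (u :: l).getLast? = some w →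
      ∃ p : G.Walk u w, p.support = u :: l := by
  induction l with
  | nil =>
    intro u w _ h
    simp at h
    subst h
    exact ⟨SimpleGraph.Walk.nil, rfl⟩
  | cons x l ih =>
    intro u w hc h
    rw [List.isChain_cons_cons] at hc
    obtain ⟨p, hp⟩ := ih x w hc.2 (by simpa using h)
    exact ⟨SimpleGraph.Walk.cons hc.1 p, by simp [hp]⟩

set_option maxRecDepth 100000 in
lemma bmePath_ok : ∀ a b : Fin 12, (bmePath 12 a b).head? = some a ∧
    (bmePath 12 a b).getLast? = some b ∧ (bmePath 12 a b).Nodup ∧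
    List.IsChain bmeG.Adj (bmePath 12 a b) := by
  decide +kernel

lemma bme_path_exists (a b : Fin 12) :
    ∃ p : bmeG.Walk a b, p.IsPath ∧ p.support = bmePath 12 a b := by
  obtain ⟨h1, h2, h3, h4⟩ := bmePath_ok a b
  generalize bmePath 12 a b = l at h1 h2 h3 h4
  cases l with
  | nil => simp at h1
  | cons u l =>
    simp at h1
    subst h1
    obtain ⟨p, hp⟩ := bme_walk_of_chain l u b h4 h2
    exact ⟨p, by rw [SimpleGraph.Walk.isPath_def, hp]; exact h3, hp⟩

lemma bmeG_tree : bmeG.IsTree := by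
  rw [SimpleGraph.isTree_iff_connected_and_card]
  refine ⟨⟨fun a b => ?_⟩, ?_⟩
  · exact ⟨(bme_path_exists a b).choose⟩
  · rw [Nat.card_eq_fintype_card, Nat.card_eq_fintype_card,
      ← SimpleGraph.edgeFinset_card]
    decide +kernel

lemma bmeG_deg (v : Fin 12) :
    (bmeG.neighborSet v).ncard = if v.val < 7 then 1 else 3 := by
  rw [Set.ncard_eq_toFinset_card']
  revert v
  decide +kernel

/-- The binary tree of the fixed shape with leaf positions given by `f`. -/
def bmeMk (f : Fin 7 → Fin 12) (hf : Function.Injective f)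
    (hr : ∀ v, v.val < 7 ↔ ∃ i, f i = v) : PhyloTree 7 where
  V := Fin 12
  fin := inferInstance
  G := bmeG
  tree := bmeG_tree
  leaf := f
  inj := hf
  leafDeg i := by rw [bmeG_deg, if_pos ((hr _).2 ⟨i, rfl⟩)]
  leafAll v h := by
    rw [bmeG_deg] at h
    refine (hr v).1 ?_
    by_contra hv
    rw [if_neg hv] at h
    omega
  internalDeg v h := by
    rw [bmeG_deg, if_neg]
    rw [hr]
    push Not
    exact h

lemma bmeMk_binary (f hf hr) : (bmeMk f hf hr).IsBinary := by
  intro (v : Fin 12) h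
  change (bmeG.neighborSet v).ncard = 3
  rw [bmeG_deg, if_neg]
  rw [hr]
  push Not
  exact h

/-- Number of internal vertices on the path. -/
def bmeK (a b : Fin 12) : ℕ := ((bmePath 12 a b).filter (fun v => 7 ≤ v.val)).length

lemma bme_prod (l : List (Fin 12)) :
    (l.map (fun v => if v.val < 7 then (1 : ℝ) else 1 / 2)).prod
      = (1 / 2) ^ (l.filter (fun v => 7 ≤ v.val)).length := by
  induction l with
  | nil => simp
  | cons x l ih =>
    rw [List.map_cons, List.prod_cons, ih, List.filter_cons]
    by_cases h : x.val < 7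
    · have h' : ¬ 7 ≤ x.val := by omega
      simp [h, h']
    · have h' : 7 ≤ x.val := by omega
      simp [h, h', pow_succ, mul_comm]

lemma bmeMk_lam (f hf hr) (a b : Fin 7) :
    (bmeMk f hf hr).lam a b = (1 / 2) ^ bmeK (f a) (f b) := by
  obtain ⟨p, hp, hs⟩ := bme_path_exists (f a) (f b)
  have hu := (bmeMk f hf hr).tree.existsUnique_path
    ((bmeMk f hf hr).leaf a) ((bmeMk f hf hr).leaf b)
  have he : ((bmeMk f hf hr).tree.existsUnique_path
    ((bmeMk f hf hr).leaf a) ((bmeMk f hf hr).leaf b)).choose = p :=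
    hu.unique hu.choose_spec.1 hp
  rw [bmeK, ← bme_prod, ← hs]
  unfold PhyloTree.lam
  rw [he]
  congr 1
  apply List.map_congr_left
  intro (v : Fin 12) _
  have hv := hr v
  by_cases h : v.val < 7
  · obtain ⟨i, hi⟩ := hv.1 h
    exact (if_neg (fun h => h i hi)).trans (if_pos h).symm
  · have hi : ∀ i, f i ≠ v := fun i hi => h (hv.2 ⟨i, hi⟩)
    refine (if_pos hi).trans (Eq.trans ?_ (if_neg h).symm)
    change (((bmeG.neighborSet v).ncard : ℝ) - 1)⁻¹ = 1 / 2
    rw [bmeG_deg, if_neg h]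
    norm_num

lemma bmeK_le : ∀ a b : Fin 12, bmeK a b ≤ 6 := by
  decide +kernel

/-- `64 λ` as a natural number. -/
def bmeN (a b : Fin 12) : ℕ := 2 ^ (6 - bmeK a b)

lemma bmeMk_vec (f hf hr) (p : LeafPairs 7) :
    (bmeMk f hf hr).bmeVec p = (bmeN (f p.1.1) (f p.1.2) : ℝ) / 64 := by
  change (bmeMk f hf hr).lam _ _ = _
  rw [bmeMk_lam, bmeN]
  have h := bmeK_le (f p.1.1) (f p.1.2)
  interval_cases bmeK (f p.1.1) (f p.1.2) <;> norm_num

lemma bmeMk_ne (f hf hr g hg hs) (p : LeafPairs 7)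
    (h : bmeN (f p.1.1) (f p.1.2) ≠ bmeN (g p.1.1) (g p.1.2)) :
    (bmeMk f hf hr).bmeVec ≠ (bmeMk g hg hs).bmeVec := by
  intro he
  have := congrFun he p
  rw [bmeMk_vec, bmeMk_vec] at this
  apply h
  have h2 : (bmeN (f p.1.1) (f p.1.2) : ℝ) = bmeN (g p.1.1) (g p.1.2) := by linarith
  exact_mod_cast h2

def bmeF1 : Fin 7 → Fin 12 := ![1, 5, 3, 0, 4, 6, 2]
def bmeF2 : Fin 7 → Fin 12 := ![1, 3, 5, 2, 4, 6, 0]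
def bmeF3 : Fin 7 → Fin 12 := ![1, 5, 3, 2, 4, 6, 0]
def bmeF4 : Fin 7 → Fin 12 := ![1, 3, 5, 0, 4, 6, 2]

def bmeT1 : PhyloTree 7 := bmeMk bmeF1 (by decide +kernel) (by decide +kernel)
def bmeT2 : PhyloTree 7 := bmeMk bmeF2 (by decide +kernel) (by decide +kernel)
def bmeT3 : PhyloTree 7 := bmeMk bmeF3 (by decide +kernel) (by decide +kernel)
def bmeT4 : PhyloTree 7 := bmeMk bmeF4 (by decide +kernel) (by decide +kernel)

lemma bme_rel : ∀ a b : Fin 7, a < b →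
    bmeN (bmeF1 a) (bmeF1 b) + bmeN (bmeF2 a) (bmeF2 b)
      = bmeN (bmeF3 a) (bmeF3 b) + bmeN (bmeF4 a) (bmeF4 b) := by
  decide +kernel

lemma bme_rel_real (p : LeafPairs 7) :
    bmeT1.bmeVec p + bmeT2.bmeVec p = bmeT3.bmeVec p + bmeT4.bmeVec p := by
  unfold bmeT1 bmeT2 bmeT3 bmeT4
  rw [bmeMk_vec, bmeMk_vec, bmeMk_vec, bmeMk_vec]
  have h := bme_rel p.1.1 p.1.2 p.2
  have h' : (bmeN (bmeF1 p.1.1) (bmeF1 p.1.2) : ℝ) + bmeN (bmeF2 p.1.1) (bmeF2 p.1.2)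
      = bmeN (bmeF3 p.1.1) (bmeF3 p.1.2) + bmeN (bmeF4 p.1.1) (bmeF4 p.1.2) := by
    exact_mod_cast h
  linarith

lemma bmeT1_cherry : bmeT1.cherryCount = 3 := by
  change Set.ncard {p : Fin 7 × Fin 7 |
    p.1 < p.2 ∧ ∃ v : Fin 12, bmeG.Adj (bmeF1 p.1) v ∧ bmeG.Adj (bmeF1 p.2) v} = 3
  rw [Set.ncard_eq_toFinset_card']
  decide +kernel

lemma bmeT2_cherry : bmeT2.cherryCount = 3 := by
  change Set.ncard {p : Fin 7 × Fin 7 |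
    p.1 < p.2 ∧ ∃ v : Fin 12, bmeG.Adj (bmeF2 p.1) v ∧ bmeG.Adj (bmeF2 p.2) v} = 3
  rw [Set.ncard_eq_toFinset_card']
  decide +kernel

/-- The BME polytope for `n = 7` has a non-edge: there are two binary trees `T₁, T₂`
on `{1,…,7}`, each with exactly three cherries and with distinct BME vectors, such that
whenever `v_{T₁}·D = v_{T₂}·D ≤ v_T·D` for all binary trees `T`, some binary tree `T₃`
with `v_{T₃} ∉ {v_{T₁}, v_{T₂}}` also satisfies `v_{T₃}·D = v_{T₁}·D`; that is,
`T₁` and `T₂` can never be the only co-optimal BME trees. -/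
theorem bme_polytope_seven_has_nonedge :
    ∃ T₁ T₂ : PhyloTree 7, T₁.IsBinary ∧ T₂.IsBinary ∧
      T₁.cherryCount = 3 ∧ T₂.cherryCount = 3 ∧ T₁.bmeVec ≠ T₂.bmeVec ∧
      ∀ D : LeafPairs 7 → ℝ,
        (∑ p, T₁.bmeVec p * D p) = (∑ p, T₂.bmeVec p * D p) →
        (∀ T : PhyloTree 7, T.IsBinary →
          (∑ p, T₁.bmeVec p * D p) ≤ (∑ p, T.bmeVec p * D p)) →
        ∃ T₃ : PhyloTree 7, T₃.IsBinary ∧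
          T₃.bmeVec ≠ T₁.bmeVec ∧ T₃.bmeVec ≠ T₂.bmeVec ∧
          (∑ p, T₃.bmeVec p * D p) = (∑ p, T₁.bmeVec p * D p) := by
  refine ⟨bmeT1, bmeT2, bmeMk_binary _ _ _, bmeMk_binary _ _ _, bmeT1_cherry, bmeT2_cherry,
    bmeMk_ne _ _ _ _ _ _ ⟨(1, 4), by decide⟩ (by decide +kernel), ?_⟩
  intro D h12 hmin
  refine ⟨bmeT3, bmeMk_binary _ _ _,
    bmeMk_ne _ _ _ _ _ _ ⟨(0, 3), by decide⟩ (by decide +kernel),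
    bmeMk_ne _ _ _ _ _ _ ⟨(1, 4), by decide⟩ (by decide +kernel), ?_⟩
  have h3 := hmin bmeT3 (bmeMk_binary _ _ _)
  have h4 := hmin bmeT4 (bmeMk_binary _ _ _)
  have hs : (∑ p, bmeT1.bmeVec p * D p) + (∑ p, bmeT2.bmeVec p * D p)
      = (∑ p, bmeT3.bmeVec p * D p) + (∑ p, bmeT4.bmeVec p * D p) := by
    rw [← Finset.sum_add_distrib, ← Finset.sum_add_distrib]
    refine Finset.sum_congr rfl fun p _ => ?_
    rw [← add_mul, ← add_mul, bme_rel_real]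
  linarith
end

section
/- For n ≥ 3, the affine span of the set of BME vectors of all binary phylogenetic trees on leaf set {1,…,n} has dimension C(n,2) − n; that is, the BME polytope lies in ℝ^{C(n,2)} and has dimension C(n,2) − n. -/
namespace PhyloTree
open Classical in
/-- vertex weight -/
noncomputable def wt {n : ℕ} (T : PhyloTree n) (v : T.V) : ℝ :=
  if ∀ i, T.leaf i ≠ v then (((T.G.neighborSet v).ncard : ℝ) - 1)⁻¹ else 1

/-- the unique path -/
noncomputable def pth {n : ℕ} (T : PhyloTree n) (u v : T.V) : T.G.Walk u v :=
  (T.tree.existsUnique_path u v).choose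

lemma pth_isPath {n : ℕ} (T : PhyloTree n) (u v : T.V) : (T.pth u v).IsPath :=
  (T.tree.existsUnique_path u v).choose_spec.1

lemma pth_unique {n : ℕ} (T : PhyloTree n) {u v : T.V} {p : T.G.Walk u v} (hp : p.IsPath) :
    p = T.pth u v :=
  (T.tree.existsUnique_path u v).choose_spec.2 p hp

/-- weight of path -/
noncomputable def pw {n : ℕ} (T : PhyloTree n) (u v : T.V) : ℝ :=
  ((T.pth u v).support.map T.wt).prod

lemma lam_eq {n : ℕ} (T : PhyloTree n) (a b : Fin n) :
    T.lam a b = T.pw (T.leaf a) (T.leaf b) := rfl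

lemma wt_leaf {n : ℕ} (T : PhyloTree n) (a : Fin n) : T.wt (T.leaf a) = 1 := by
  unfold wt
  rw [if_neg]
  intro h
  exact h a rfl

lemma wt_int {n : ℕ} (T : PhyloTree n) (v : T.V) (hv : ∀ i, T.leaf i ≠ v) :
    T.wt v = (((T.G.neighborSet v).ncard : ℝ) - 1)⁻¹ := by
  unfold wt
  rw [if_pos hv]

lemma wt_pos {n : ℕ} (T : PhyloTree n) (v : T.V) : 0 < T.wt v := by
  by_cases h : ∀ i, T.leaf i ≠ v
  · rw [wt_int T v h]
    have := T.internalDeg v h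
    have h3 : (3 : ℝ) ≤ ((T.G.neighborSet v).ncard : ℝ) := by exact_mod_cast this
    apply inv_pos.mpr
    linarith
  · push Not at h
    obtain ⟨i, rfl⟩ := h
    rw [wt_leaf]; norm_num

lemma lam_pos {n : ℕ} (T : PhyloTree n) (a b : Fin n) : 0 < T.lam a b := by
  rw [lam_eq]
  unfold pw
  apply List.prod_pos
  intro x hx
  obtain ⟨v, -, rfl⟩ := List.mem_map.mp hx
  exact T.wt_pos v

lemma lam_symm {n : ℕ} (T : PhyloTree n) (a b : Fin n) : T.lam a b = T.lam b a := by
  rw [lam_eq, lam_eq]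
  unfold pw
  rw [← T.pth_unique (T.pth_isPath (T.leaf b) (T.leaf a)).reverse, SimpleGraph.Walk.support_reverse,
    List.map_reverse, List.prod_reverse]

/-- parent -/
noncomputable def par {n : ℕ} (T : PhyloTree n) (r v : T.V) : T.V := (T.pth r v).penultimate

lemma par_adj {n : ℕ} (T : PhyloTree n) {r v : T.V} (h : v ≠ r) : T.G.Adj (T.par r v) v :=
  SimpleGraph.Walk.adj_penultimate (fun hn => h hn.eq.symm)

lemma pth_self {n : ℕ} (T : PhyloTree n) (r : T.V) : T.pth r r = SimpleGraph.Walk.nil :=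
  (T.pth_unique SimpleGraph.Walk.IsPath.nil).symm

lemma pth_concat {n : ℕ} (T : PhyloTree n) {r u v : T.V} (h : T.G.Adj u v)
    (hu : u ∈ (T.pth r v).support) : T.pth r v = (T.pth r u).concat h :=
  T.tree.isAcyclic.path_concat (T.pth_isPath r u) (T.pth_isPath r v) h hu

lemma par_mem {n : ℕ} (T : PhyloTree n) (r v : T.V) : T.par r v ∈ (T.pth r v).support :=
  SimpleGraph.Walk.getVert_mem_support _ _

lemma pw_par {n : ℕ} (T : PhyloTree n) {r v : T.V} (h : v ≠ r) :
    T.pw r v = T.pw r (T.par r v) * T.wt v := by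
  conv_lhs => unfold pw
  rw [T.pth_concat (T.par_adj h) (T.par_mem r v), SimpleGraph.Walk.support_concat]
  simp [pw]

lemma par_or {n : ℕ} (T : PhyloTree n) {r u v : T.V} (h : T.G.Adj u v) :
    (v ≠ r ∧ T.par r v = u) ∨ (u ≠ r ∧ T.par r u = v) := by
  by_cases hu : u ∈ (T.pth r v).support
  · left
    constructor
    · rintro rfl
      rw [pth_self] at hu
      simp at hu
      exact h.ne hu
    · unfold par
      rw [T.pth_concat h hu, SimpleGraph.Walk.penultimate_concat]
  · right
    have hv := T.tree.isAcyclic.mem_support_of_ne_mem_support_of_adj_of_isPath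
      (T.pth_isPath r u) (T.pth_isPath r v) h hu
    constructor
    · rintro rfl
      exact hu (SimpleGraph.Walk.start_mem_support _)
    · unfold par
      rw [T.pth_concat h.symm hv, SimpleGraph.Walk.penultimate_concat]

lemma not_both {n : ℕ} (T : PhyloTree n) {r u v : T.V} (hv : v ≠ r) (hu : u ≠ r)
    (h1 : T.par r v = u) (h2 : T.par r u = v) : False := by
  have a1 := T.pth_concat (T.par_adj hv) (T.par_mem r v)
  have a2 := T.pth_concat (T.par_adj hu) (T.par_mem r u)
  have b1 := congrArg SimpleGraph.Walk.length a1
  have b2 := congrArg SimpleGraph.Walk.length a2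
  rw [SimpleGraph.Walk.length_concat] at b1 b2
  rw [h1] at b1
  rw [h2] at b2
  omega

lemma children_count {n : ℕ} (T : PhyloTree n) {r u : T.V} (hu : u ≠ r) :
    {v : T.V | v ≠ r ∧ T.par r v = u}.ncard + 1 = (T.G.neighborSet u).ncard := by
  have := T.fin
  have : T.G.neighborSet u = insert (T.par r u) {v : T.V | v ≠ r ∧ T.par r v = u} := by
    ext v
    simp only [SimpleGraph.mem_neighborSet, Set.mem_insert_iff, Set.mem_ofPred_eq]
    constructor
    · intro h
      rcases T.par_or (r := r) h with h | h
      · exact Or.inr h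
      · exact Or.inl h.2.symm
    · rintro (rfl | ⟨h1, rfl⟩)
      · exact (T.par_adj hu).symm
      · exact T.par_adj h1
  rw [this, Set.ncard_insert_of_notMem]
  rintro ⟨h1, h2⟩
  exact T.not_both h1 hu h2 rfl

lemma children_count_root {n : ℕ} (T : PhyloTree n) (r : T.V) :
    {v : T.V | v ≠ r ∧ T.par r v = r}.ncard = (T.G.neighborSet r).ncard := by
  congr 1
  ext v
  simp only [SimpleGraph.mem_neighborSet, Set.mem_ofPred_eq]
  constructor
  · rintro ⟨h1, h2⟩
    have := T.par_adj h1
    rwa [h2] at this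
  · intro h
    rcases T.par_or (r := r) h with h | h
    · exact h
    · exact absurd rfl h.1

open Classical in
lemma row_sum {n : ℕ} (T : PhyloTree n) (a : Fin n) :
    ∑ b ∈ Finset.univ.erase a, T.lam a b = 1 := by
  have := T.fin
  set r := T.leaf a with hr
  have key : ∑ v ∈ Finset.univ.filter (fun v => v ≠ r), T.pw r (T.par r v)
      = ∑ u, ({v : T.V | v ≠ r ∧ T.par r v = u}.ncard : ℝ) * T.pw r u := by
    rw [← Finset.sum_fiberwise (Finset.univ.filter (fun v => v ≠ r)) (T.par r)]
    apply Finset.sum_congr rfl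
    intro u _
    rw [Finset.sum_congr rfl (g := fun _ => T.pw r u)]
    · rw [Finset.sum_const, nsmul_eq_mul, Set.ncard_eq_toFinset_card', Finset.filter_filter]
      simp
    · intro v hv
      rw [(Finset.mem_filter.mp hv).2]
  have hself : T.pw r r = 1 := by
    unfold pw
    rw [pth_self]
    simp [hr, wt_leaf]
  rw [← Finset.add_sum_erase _ _ (Finset.mem_univ r), children_count_root, hself, hr, T.leafDeg,
    ← hr] at key
  have e1 : (Finset.univ : Finset T.V).erase r = Finset.univ.filter (fun v => v ≠ r) := by
    ext v; simp
  rw [e1, ← Finset.sum_filter_add_sum_filter_not _ (fun v => ∃ i, T.leaf i = v),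
    ← Finset.sum_filter_add_sum_filter_not (Finset.univ.filter (fun v => v ≠ r))
      (fun v => ∃ i, T.leaf i = v)
      (fun u => ({v : T.V | v ≠ r ∧ T.par r v = u}.ncard : ℝ) * T.pw r u)] at key
  have z1 : ∑ u ∈ (Finset.univ.filter (fun v => v ≠ r)).filter (fun v => ∃ i, T.leaf i = v),
      ({v : T.V | v ≠ r ∧ T.par r v = u}.ncard : ℝ) * T.pw r u = 0 := by
    apply Finset.sum_eq_zero
    intro u hu
    simp only [Finset.mem_filter, Finset.mem_univ, true_and] at hu
    obtain ⟨h1, i, rfl⟩ := hu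
    have := T.children_count h1
    rw [T.leafDeg] at this
    have : {v : T.V | v ≠ r ∧ T.par r v = T.leaf i}.ncard = 0 := by omega
    rw [this]; simp
  have z2 : ∑ u ∈ (Finset.univ.filter (fun v => v ≠ r)).filter (fun v => ¬ ∃ i, T.leaf i = v),
      ({v : T.V | v ≠ r ∧ T.par r v = u}.ncard : ℝ) * T.pw r u
      = ∑ u ∈ (Finset.univ.filter (fun v => v ≠ r)).filter (fun v => ¬ ∃ i, T.leaf i = v),
        T.pw r (T.par r u) := by
    apply Finset.sum_congr rfl
    intro u hu
    simp only [Finset.mem_filter, Finset.mem_univ, true_and, not_exists] at hu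
    have h3 := T.children_count hu.1
    have h4 := T.internalDeg u hu.2
    rw [T.pw_par hu.1, T.wt_int u hu.2, ← h3]
    have : ({v : T.V | v ≠ r ∧ T.par r v = u}.ncard : ℝ) ≠ 0 := by
      have : {v : T.V | v ≠ r ∧ T.par r v = u}.ncard ≠ 0 := by omega
      exact_mod_cast this
    push_cast
    rw [add_sub_cancel_right, mul_comm (T.pw r (T.par r u)), ← mul_assoc, mul_inv_cancel₀ this,
      one_mul]
  have z3 : ∑ u ∈ (Finset.univ.filter (fun v => v ≠ r)).filter (fun v => ∃ i, T.leaf i = v),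
      T.pw r (T.par r u) = ∑ b ∈ Finset.univ.erase a, T.lam a b := by
    symm
    apply Finset.sum_bij (fun b _ => T.leaf b)
    · intro b hb
      simp only [Finset.mem_erase, Finset.mem_univ, and_true] at hb
      simp only [Finset.mem_filter, Finset.mem_univ, true_and]
      exact ⟨fun h => hb (T.inj h), b, rfl⟩
    · intro b _ c _ h
      exact T.inj h
    · intro v hv
      simp only [Finset.mem_filter, Finset.mem_univ, true_and] at hv
      obtain ⟨h1, i, rfl⟩ := hv
      refine ⟨i, ?_, rfl⟩
      simp only [Finset.mem_erase, Finset.mem_univ, and_true]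
      rintro rfl
      exact h1 rfl
    · intro b hb
      simp only [Finset.mem_erase, Finset.mem_univ, and_true] at hb
      have : T.leaf b ≠ r := fun h => hb (T.inj h)
      rw [lam_eq, ← hr, T.pw_par this, wt_leaf, mul_one]
  rw [z1, z2, z3] at key
  simp only [Nat.cast_one] at key
  linarith

lemma lam_cherry {n : ℕ} (T : PhyloTree n) {a b : Fin n} {v : T.V} (hab : a ≠ b)
    (h1 : T.G.Adj (T.leaf a) v) (h2 : T.G.Adj v (T.leaf b)) (hv : ∀ i, T.leaf i ≠ v)
    (h3 : (T.G.neighborSet v).ncard = 3) : T.lam a b = 1 / 2 := by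
  have hp : (SimpleGraph.Walk.cons h1 (SimpleGraph.Walk.cons h2 SimpleGraph.Walk.nil)).IsPath := by
    simp only [SimpleGraph.Walk.cons_isPath_iff, SimpleGraph.Walk.IsPath.nil,
      SimpleGraph.Walk.support_cons, SimpleGraph.Walk.support_nil, List.mem_cons,
      List.not_mem_nil, or_false, true_and, not_or]
    exact ⟨h2.ne, h1.ne, fun h => hab (T.inj h)⟩
  rw [lam_eq]
  unfold pw
  rw [← T.pth_unique hp]
  simp [wt_leaf, T.wt_int v hv, h3]
  norm_num

/-- relabel leaves -/
def relabel {n : ℕ} (T : PhyloTree n) (σ : Equiv.Perm (Fin n)) : PhyloTree n where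
  V := T.V
  fin := T.fin
  G := T.G
  tree := T.tree
  leaf := fun i => T.leaf (σ i)
  inj := T.inj.comp σ.injective
  leafDeg := fun i => T.leafDeg (σ i)
  leafAll := fun v hv => by
    obtain ⟨i, hi⟩ := T.leafAll v hv
    exact ⟨σ.symm i, by simpa using hi⟩
  internalDeg := fun v hv => T.internalDeg v (fun i => by simpa using hv (σ.symm i))

lemma relabel_binary {n : ℕ} (T : PhyloTree n) (σ : Equiv.Perm (Fin n)) (h : T.IsBinary) :
    (T.relabel σ).IsBinary :=
  fun v hv => h v (fun i => by
    have := hv (σ.symm i)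
    simpa [relabel] using this)

lemma relabel_lam {n : ℕ} (T : PhyloTree n) (σ : Equiv.Perm (Fin n)) (a b : Fin n) :
    (T.relabel σ).lam a b = T.lam (σ a) (σ b) := by
  have : (T.relabel σ).wt = T.wt := by
    funext v
    have h : (∀ i, T.leaf (σ i) ≠ v) ↔ ∀ i, T.leaf i ≠ v :=
      ⟨fun h i => by simpa using h (σ.symm i), fun h i => h _⟩
    by_cases hv : ∀ i, T.leaf i ≠ v
    · rw [T.wt_int v hv, (T.relabel σ).wt_int v (h.mpr hv)]
      rfl
    · have hv' : ¬ ∀ i, (T.relabel σ).leaf i ≠ v := fun h' => hv (h.mp h')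
      unfold wt
      rw [if_neg hv, if_neg hv']
  rw [lam_eq, lam_eq]
  unfold pw
  rw [this]
  rfl

end PhyloTree


section Caterpillar

/-- graph from a parent function -/
def parGraph {m : ℕ} (f : Fin m → Fin m) : SimpleGraph (Fin m) where
  Adj u v := u ≠ v ∧ (f u = v ∨ f v = u)
  symm := ⟨fun _ _ h => ⟨h.1.symm, h.2.symm⟩⟩
  loopless := ⟨fun _ h => h.1 rfl⟩

lemma parGraph_isTree {m : ℕ} (f : Fin (m + 1) → Fin (m + 1))
    (hf0 : f 0 = 0) (hf : ∀ v, v ≠ 0 → f v < v) : (parGraph f).IsTree := by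
  have hconn0 : ∀ k : ℕ, ∀ v : Fin (m + 1), v.val = k → (parGraph f).Reachable v 0 := by
    intro k
    induction k using Nat.strong_induction_on with
    | _ k ih =>
      intro v hv
      by_cases h0 : v = 0
      · subst h0; exact SimpleGraph.Reachable.refl _
      · have h1 := hf v h0
        have h2 := ih (f v).val (by rw [← hv]; exact h1) (f v) rfl
        have h3 : (parGraph f).Adj v (f v) := ⟨h1.ne', Or.inl rfl⟩
        exact h3.reachable.trans h2
  have hconn : (parGraph f).Connected := by
    rw [SimpleGraph.connected_iff_exists_forall_reachable]
    exact ⟨0, fun v => (hconn0 _ v rfl).symm⟩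
  rw [SimpleGraph.isTree_iff_connected_and_card]
  refine ⟨hconn, le_antisymm ?_ hconn.card_vert_le_card_edgeSet_add_one⟩
  have hsub : (parGraph f).edgeSet ⊆ (fun v => s(v, f v)) '' {v : Fin (m + 1) | v ≠ 0} := by
    intro e he
    induction e using Sym2.ind with
    | _ u v =>
      rw [SimpleGraph.mem_edgeSet] at he
      obtain ⟨h1, h2 | h2⟩ := he
      · refine ⟨u, ?_, by simp [h2]⟩
        rintro rfl
        exact h1 (by rw [← h2, hf0])
      · refine ⟨v, ?_, by simp [h2, Sym2.eq_swap]⟩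
        rintro rfl
        exact h1 (by rw [← h2, hf0])
  have h1 : (parGraph f).edgeSet.ncard ≤ {v : Fin (m + 1) | v ≠ 0}.ncard :=
    (Set.ncard_le_ncard hsub).trans (Set.ncard_image_le)
  have h2 : {v : Fin (m + 1) | v ≠ 0}.ncard = m := by
    rw [Set.ncard_eq_toFinset_card']
    simp [Finset.filter_ne']
  rw [Nat.card_coe_set_eq]
  simp only [Nat.card_eq_fintype_card, Fintype.card_fin]
  omega

/-- parent function of the caterpillar with `k + 4` leaves -/
def catPar (k : ℕ) (v : Fin (2 * k + 5 + 1)) : Fin (2 * k + 5 + 1) :=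
  if v.val = 2 * k + 5 then 0
  else if v.val % 2 = 1 then ⟨v.val - 1, by omega⟩ else ⟨v.val - 2, by omega⟩

lemma catPar_val (k : ℕ) (v : Fin (2 * k + 5 + 1)) : (catPar k v).val =
    if v.val = 2 * k + 5 then 0 else if v.val % 2 = 1 then v.val - 1 else v.val - 2 := by
  unfold catPar
  split_ifs <;> simp

lemma cat_adj (k : ℕ) (u v : Fin (2 * k + 5 + 1)) : (parGraph (catPar k)).Adj u v ↔
    u.val ≠ v.val ∧ ((catPar k u).val = v.val ∨ (catPar k v).val = u.val) := by
  simp [parGraph, Fin.ext_iff]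

/-- leaves of the caterpillar -/
def catLeaf (k : ℕ) (i : Fin (k + 4)) : Fin (2 * k + 5 + 1) :=
  if h : i.val < k + 3 then ⟨2 * i.val + 1, by omega⟩ else ⟨2 * k + 4, by omega⟩

lemma catLeaf_val (k : ℕ) (i : Fin (k + 4)) : (catLeaf k i).val =
    if i.val < k + 3 then 2 * i.val + 1 else 2 * k + 4 := by
  unfold catLeaf
  split_ifs <;> simp

lemma catLeaf_iff (k : ℕ) (v : Fin (2 * k + 5 + 1)) :
    (∃ i, catLeaf k i = v) ↔ (v.val % 2 = 1 ∨ v.val = 2 * k + 4) := by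
  constructor
  · rintro ⟨i, rfl⟩
    rw [catLeaf_val]
    split_ifs <;> omega
  · rintro (h | h)
    · refine ⟨⟨v.val / 2, by omega⟩, ?_⟩
      apply Fin.ext
      rw [catLeaf_val]
      have := v.isLt
      rw [if_pos (by simp only; omega)]
      simp only
      omega
    · refine ⟨⟨k + 3, by omega⟩, ?_⟩
      apply Fin.ext
      rw [catLeaf_val]
      simp [h]

lemma cat_leaf_deg (k : ℕ) (v : Fin (2 * k + 5 + 1)) (h : v.val % 2 = 1 ∨ v.val = 2 * k + 4) :
    ((parGraph (catPar k)).neighborSet v).ncard = 1 := by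
  rw [Set.ncard_eq_one]
  refine ⟨catPar k v, ?_⟩
  ext u
  rw [SimpleGraph.mem_neighborSet, cat_adj, Set.mem_singleton_iff, Fin.ext_iff, catPar_val,
    catPar_val]
  have := v.isLt
  have := u.isLt
  constructor
  · rintro ⟨h1, h2⟩
    split_ifs at * <;> omega
  · intro h1
    split_ifs at * <;> omega

lemma cat_int_deg (k : ℕ) (v : Fin (2 * k + 5 + 1)) (h : ¬ (v.val % 2 = 1 ∨ v.val = 2 * k + 4)) :
    ((parGraph (catPar k)).neighborSet v).ncard = 3 := by
  rw [Set.ncard_eq_three]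
  have hv := v.isLt
  refine ⟨⟨if v.val = 0 then 2 * k + 5 else v.val - 2, by split_ifs <;> omega⟩,
    ⟨v.val + 1, by omega⟩, ⟨v.val + 2, by omega⟩, ?_, ?_, ?_, ?_⟩
  · intro h; rw [Fin.ext_iff] at h; simp only at h; split_ifs at h <;> omega
  · intro h; rw [Fin.ext_iff] at h; simp only at h; split_ifs at h <;> omega
  · intro h; rw [Fin.ext_iff] at h; simp only at h; omega
  ext u
  have := u.isLt
  rw [SimpleGraph.mem_neighborSet, cat_adj]
  simp only [Set.mem_insert_iff, Set.mem_singleton_iff, Fin.ext_iff, catPar_val]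
  constructor
  · rintro ⟨h1, h2⟩
    split_ifs at * <;> omega
  · intro h1
    split_ifs at * <;> omega

/-- the caterpillar -/
def cat (k : ℕ) : PhyloTree (k + 4) where
  V := Fin (2 * k + 5 + 1)
  fin := inferInstance
  G := parGraph (catPar k)
  tree := parGraph_isTree _ (by apply Fin.ext; rw [catPar_val]; simp) (by
    intro v hv
    have h0 : v.val ≠ 0 := fun h => hv (Fin.ext h)
    rw [Fin.lt_def, catPar_val]
    split_ifs <;> omega)
  leaf := catLeaf k
  inj := by
    intro i j h
    rw [Fin.ext_iff, catLeaf_val, catLeaf_val] at h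
    apply Fin.ext
    split_ifs at h <;> omega
  leafDeg := fun i => cat_leaf_deg k _ ((catLeaf_iff k _).mp ⟨i, rfl⟩)
  leafAll := by
    intro v hv
    rw [catLeaf_iff]
    by_contra h
    rw [cat_int_deg k v h] at hv
    omega
  internalDeg := by
    intro v hv
    rw [cat_int_deg k v]
    rw [← catLeaf_iff]
    push Not
    exact hv

lemma cat_binary (k : ℕ) : (cat k).IsBinary := by
  intro v hv
  refine cat_int_deg k v (fun h => ?_)
  obtain ⟨i, hi⟩ := (catLeaf_iff k v).mpr h
  exact hv i hi

lemma cat_cherry (k : ℕ) (a b : Fin (k + 4)) (hab : a ≠ b) (v : Fin (2 * k + 5 + 1))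
    (h : ¬ (v.val % 2 = 1 ∨ v.val = 2 * k + 4))
    (ha : catPar k (catLeaf k a) = v) (hb : catPar k (catLeaf k b) = v) :
    (cat k).lam a b = 1 / 2 := by
  have hv : ∀ i, catLeaf k i ≠ v := by
    rw [← catLeaf_iff] at h
    push Not at h
    exact h
  exact PhyloTree.lam_cherry (cat k) (v := v) hab ⟨hv a, Or.inl ha⟩ ⟨(hv b).symm, Or.inr hb⟩ hv
    (cat_int_deg k v h)

lemma exists_two_cherries (n : ℕ) (hn : 4 ≤ n) : ∃ T : PhyloTree n, T.IsBinary ∧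
    ∃ x : Fin 4 ↪ Fin n, T.lam (x 0) (x 1) = 1 / 2 ∧ T.lam (x 2) (x 3) = 1 / 2 := by
  obtain ⟨k, rfl⟩ : ∃ k, n = k + 4 := ⟨n - 4, by omega⟩
  refine ⟨cat k, cat_binary k, ⟨![⟨0, by omega⟩, ⟨k + 2, by omega⟩, ⟨k + 1, by omega⟩,
    ⟨k + 3, by omega⟩], ?_⟩, ?_, ?_⟩
  · intro i j h
    fin_cases i <;> fin_cases j <;> simp [Fin.ext_iff] at h ⊢ <;> omega
  · apply cat_cherry k _ _ _ ⟨0, by omega⟩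
    · simp
    · apply Fin.ext; rw [catPar_val, catLeaf_val]; simp
    · apply Fin.ext; rw [catPar_val, catLeaf_val]; simp; omega
    · simp
  · apply cat_cherry k _ _ _ ⟨2 * k + 2, by omega⟩
    · simp
    · apply Fin.ext; rw [catPar_val, catLeaf_val]; simp; split_ifs <;> omega
    · apply Fin.ext; rw [catPar_val, catLeaf_val]; simp
    · simp

end Caterpillar


section LinAlg

lemma card_leafPairs (n : ℕ) : Fintype.card (LeafPairs n) = n.choose 2 := by
  rw [Fintype.card_subtype]
  have : (Finset.univ.filter (fun p : Fin n × Fin n => p.1 < p.2)).card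
      = ∑ b : Fin n, b.val := by
    rw [Finset.card_filter, Fintype.sum_prod_type_right]
    apply Finset.sum_congr rfl
    intro b _
    rw [← Finset.card_filter]
    have : Finset.univ.filter (fun x : Fin n => x < b) = Finset.Iio b := by ext; simp
    simp only [this, Fin.card_Iio]
  rw [this, Fin.sum_univ_eq_sum_range (fun i => i) n, Finset.sum_range_id, Nat.choose_two_right]

/-- row sums -/
noncomputable def rowMap (n : ℕ) : (LeafPairs n → ℝ) →ₗ[ℝ] (Fin n → ℝ) where
  toFun x a := ∑ p : LeafPairs n, ((if p.1.1 = a then x p else 0) + (if p.1.2 = a then x p else 0))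
  map_add' x y := by
    funext a
    simp only [Pi.add_apply]
    rw [← Finset.sum_add_distrib]
    apply Finset.sum_congr rfl
    intro p _
    split_ifs <;> ring
  map_smul' c x := by
    funext a
    simp only [Pi.smul_apply, smul_eq_mul, RingHom.id_apply]
    rw [Finset.mul_sum]
    apply Finset.sum_congr rfl
    intro p _
    split_ifs <;> ring

lemma rowMap_apply (n : ℕ) (x : LeafPairs n → ℝ) (a : Fin n) : rowMap n x a =
    ∑ p : LeafPairs n, ((if p.1.1 = a then x p else 0) + (if p.1.2 = a then x p else 0)) := rfl

lemma rowMap_dual (n : ℕ) (x : LeafPairs n → ℝ) (y : Fin n → ℝ) :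
    ∑ a, y a * rowMap n x a = ∑ p : LeafPairs n, (y p.1.1 + y p.1.2) * x p := by
  simp only [rowMap_apply, Finset.mul_sum]
  rw [Finset.sum_comm]
  apply Finset.sum_congr rfl
  intro p _
  simp only [mul_add, Finset.sum_add_distrib, mul_ite, mul_zero]
  simp
  ring

lemma sum_sym (n : ℕ) (f : Fin n → Fin n → ℝ) :
    ∑ p : LeafPairs n, (f p.1.1 p.1.2 + f p.1.2 p.1.1)
      = ∑ a, ∑ b, if a ≠ b then f a b else 0 := by
  have h1 : ∀ g : Fin n × Fin n → ℝ, ∑ p : LeafPairs n, g p.1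
      = ∑ p : Fin n × Fin n, if p.1 < p.2 then g p else 0 := by
    intro g
    rw [← Finset.sum_filter]
    symm
    apply Finset.sum_subtype
    simp
  rw [Finset.sum_add_distrib, h1 (fun p => f p.1 p.2), h1 (fun p => f p.2 p.1),
    Fintype.sum_prod_type, Fintype.sum_prod_type_right, ← Finset.sum_add_distrib]
  apply Finset.sum_congr rfl
  intro a _
  rw [← Finset.sum_add_distrib]
  apply Finset.sum_congr rfl
  intro b _
  simp only
  rcases lt_trichotomy a b with h | h | h
  · simp [h, h.ne, h.not_gt]
  · simp [h]
  · simp [h, h.ne', h.not_gt]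

lemma rowMap_bme (n : ℕ) (T : PhyloTree n) : rowMap n T.bmeVec = fun _ => 1 := by
  funext a
  rw [rowMap_apply]
  have := sum_sym n (fun c d => if c = a then T.lam c d else 0)
  have h2 : ∑ p : LeafPairs n, ((if p.1.1 = a then T.bmeVec p else 0)
      + (if p.1.2 = a then T.bmeVec p else 0)) =
      ∑ p : LeafPairs n, ((if p.1.1 = a then T.lam p.1.1 p.1.2 else 0)
        + (if p.1.2 = a then T.lam p.1.2 p.1.1 else 0)) := by
    apply Finset.sum_congr rfl
    intro p _
    rw [T.lam_symm p.1.2 p.1.1]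
    rfl
  rw [h2, this, ← T.row_sum a, Finset.sum_eq_single a]
  · rw [← Finset.sum_filter]
    have : (Finset.univ.filter (fun b => a ≠ b)) = Finset.univ.erase a := by
      ext b; simp [eq_comm]
    rw [this]
    simp
  · intro b _ hb
    simp [hb]
  · simp

lemma rowMap_range (n : ℕ) (hn : 3 ≤ n) : LinearMap.range (rowMap n) = ⊤ := by
  by_contra h
  obtain ⟨f, hf, hle⟩ := Submodule.exists_le_ker_of_lt_top _ (lt_top_iff_ne_top.mpr h)
  apply hf
  set y : Fin n → ℝ := fun a => f (Pi.single a 1) with hy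
  have hfy : ∀ z, f z = ∑ a, y a * z a := by
    intro z
    conv_lhs => rw [LinearMap.pi_apply_eq_sum_univ f z]
    apply Finset.sum_congr rfl
    intro a _
    rw [smul_eq_mul, mul_comm, hy]
    congr 2
    funext b
    simp [Pi.single_apply, eq_comm]
  have h1 : ∀ p : LeafPairs n, y p.1.1 + y p.1.2 = 0 := by
    intro p
    have h2 : f (rowMap n (Pi.single p 1)) = 0 := hle ⟨_, rfl⟩
    rw [hfy, rowMap_dual] at h2
    simpa [Pi.single_apply] using h2
  have h3 : ∀ a b : Fin n, a ≠ b → y a + y b = 0 := by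
    intro a b hab
    rcases lt_or_gt_of_ne hab with h | h
    · exact h1 ⟨(a, b), h⟩
    · rw [add_comm]; exact h1 ⟨(b, a), h⟩
  have h4 : ∀ a, y a = 0 := by
    intro a
    obtain ⟨b, hb⟩ : ∃ b : Fin n, b ∉ ({a} : Finset (Fin n)) := by
      by_contra hc
      push Not at hc
      have := Finset.card_le_card (fun x _ => hc x : (Finset.univ : Finset (Fin n)) ⊆ {a})
      simp at this
      omega
    obtain ⟨c, hc⟩ : ∃ c : Fin n, c ∉ ({a, b} : Finset (Fin n)) := by
      by_contra hc
      push Not at hc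
      have := Finset.card_le_card (fun x _ => hc x : (Finset.univ : Finset (Fin n)) ⊆ {a, b})
      have h2 := Finset.card_le_two (a := a) (b := b)
      simp only [Finset.card_univ, Fintype.card_fin] at this
      omega
    simp only [Finset.mem_singleton, Finset.mem_insert, not_or] at hb hc
    have e1 := h3 b a hb
    have e2 := h3 c a hc.1
    have e3 := h3 c b hc.2
    linarith
  ext1 a
  simp only [LinearMap.coe_comp, Function.comp_apply, LinearMap.zero_comp, LinearMap.zero_apply]
  ext
  exact h4 a

lemma second_diff {n : ℕ} (L : Fin n → Fin n → ℝ) (hL : ∀ a b, L a b = L b a)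
    (i j k l : Fin n) (hij : i ≠ j) (hik : i ≠ k) (hil : i ≠ l) (hjk : j ≠ k) (hjl : j ≠ l)
    (hkl : k ≠ l) (a b : Fin n) (τ ρ : Equiv.Perm (Fin n)) (hτ : τ = Equiv.swap i j)
    (hρ : ρ = Equiv.swap k l) :
    L a b - L (τ a) (τ b) - L (ρ a) (ρ b) + L (τ (ρ a)) (τ (ρ b))
      = (L i k - L j k - L i l + L j l) *
        (((if a = i then 1 else 0) - (if a = j then 1 else 0)) *
          ((if b = k then 1 else 0) - (if b = l then 1 else 0)) +
        ((if a = k then 1 else 0) - (if a = l then 1 else 0)) *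
          ((if b = i then 1 else 0) - (if b = j then 1 else 0))) := by
  have T : ∀ x, τ x = if x = i then j else if x = j then i else x := by
    intro x; rw [hτ, Equiv.swap_apply_def]
  have R : ∀ x, ρ x = if x = k then l else if x = l then k else x := by
    intro x; rw [hρ, Equiv.swap_apply_def]
  have key : ∀ x, x = i ∨ x = j ∨ x = k ∨ x = l ∨ (x ≠ i ∧ x ≠ j ∧ x ≠ k ∧ x ≠ l) := by
    intro x; tauto
  have ti : τ i = j := by simp [T]
  have tj : τ j = i := by simp [T]
  have tk : τ k = k := by simp [T, hik.symm, hjk.symm]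
  have tl : τ l = l := by simp [T, hil.symm, hjl.symm]
  have ri : ρ i = i := by simp [R, hik, hil]
  have rj : ρ j = j := by simp [R, hjk, hjl]
  have rk : ρ k = l := by simp [R]
  have rl : ρ l = k := by simp [R]
  have tt : ∀ x, x ≠ i → x ≠ j → τ x = x := by intro x h1 h2; simp [T, h1, h2]
  have rr : ∀ x, x ≠ k → x ≠ l → ρ x = x := by intro x h1 h2; simp [R, h1, h2]
  rcases key a with rfl | rfl | rfl | rfl | ⟨a1, a2, a3, a4⟩ <;>
  rcases key b with rfl | rfl | rfl | rfl | ⟨b1, b2, b3, b4⟩ <;>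

  grind

/-- symmetric weight matrix -/
lemma quad {n : ℕ} (hn : 4 ≤ n) (w : Fin n → Fin n → ℝ) (hw : ∀ a b, w a b = w b a)
    (c : ℝ) (hc : ∀ T : PhyloTree n, T.IsBinary →
      ∑ p : LeafPairs n, w p.1.1 p.1.2 * T.bmeVec p = c)
    (hd : ∀ a, w a a = 0)
    (i j k l : Fin n) (hij : i ≠ j) (hik : i ≠ k) (hil : i ≠ l) (hjk : j ≠ k) (hjl : j ≠ l)
    (hkl : k ≠ l) : w i k + w j l = w j k + w i l := by
  obtain ⟨T0, hT0, x, hx1, hx2⟩ := exists_two_cherries n hn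
  have hinj : Function.Injective ![i, k, j, l] := by
    intro s t h
    fin_cases s <;> fin_cases t <;> simp_all
  obtain ⟨σ, hσ⟩ : ∃ σ : Equiv.Perm (Fin n), σ • (⟨![i, k, j, l], hinj⟩ : Fin 4 ↪ Fin n) = x :=
    have := Equiv.Perm.isMultiplyPretransitive (Fin n) 4
    MulAction.exists_smul_eq (M := Equiv.Perm (Fin n)) _ _
  have s0 : σ i = x 0 := by rw [← hσ]; rfl
  have s1 : σ k = x 1 := by rw [← hσ]; rfl
  have s2 : σ j = x 2 := by rw [← hσ]; rfl
  have s3 : σ l = x 3 := by rw [← hσ]; rfl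
  set L : Fin n → Fin n → ℝ := fun a b => T0.lam (σ a) (σ b) with hL
  have hLs : ∀ a b, L a b = L b a := fun a b => T0.lam_symm _ _
  have hF : ∀ π : Equiv.Perm (Fin n), ∑ a, ∑ b, w a b * L (π a) (π b) = 2 * c := by
    intro π
    have h1 := hc (T0.relabel (π.trans σ)) (T0.relabel_binary _ hT0)
    have h2 := sum_sym n (fun a b => w a b * L (π a) (π b))
    have h3 : ∑ p : LeafPairs n, (w p.1.1 p.1.2 * L (π p.1.1) (π p.1.2)
        + w p.1.2 p.1.1 * L (π p.1.2) (π p.1.1)) = 2 * c := by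
      rw [← h1, Finset.mul_sum]
      apply Finset.sum_congr rfl
      intro p _
      rw [hLs (π p.1.2), hw p.1.2]
      have : (T0.relabel (π.trans σ)).bmeVec p = L (π p.1.1) (π p.1.2) :=
        T0.relabel_lam _ _ _
      rw [this]; ring
    rw [← h3, h2]
    apply Finset.sum_congr rfl
    intro a _
    apply Finset.sum_congr rfl
    intro b _
    split_ifs with h
    · rfl
    · push Not at h
      rw [h, hd]; simp
  set τ := Equiv.swap i j with hτ
  set ρ := Equiv.swap k l with hρ
  have e0 := hF 1
  have e1 := hF τ
  have e2 := hF ρ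
  have e3 := hF (ρ.trans τ)
  have hsum : ∑ a, ∑ b, w a b * (L a b - L (τ a) (τ b) - L (ρ a) (ρ b) + L (τ (ρ a)) (τ (ρ b)))
      = 0 := by
    simp only [mul_add, mul_sub, Finset.sum_add_distrib, Finset.sum_sub_distrib]
    simp only [Equiv.Perm.one_apply, Equiv.trans_apply] at e0 e1 e2 e3
    linarith
  have hsum2 : ∑ a, ∑ b, w a b * (L a b - L (τ a) (τ b) - L (ρ a) (ρ b) + L (τ (ρ a)) (τ (ρ b)))
      = (L i k - L j k - L i l + L j l) * (2 * (w i k - w j k - w i l + w j l)) := by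
    simp only [second_diff L hLs i j k l hij hik hil hjk hjl hkl _ _ τ ρ hτ hρ]
    simp only [mul_add, add_mul, mul_sub, sub_mul, Finset.sum_add_distrib, Finset.sum_sub_distrib,
      mul_ite, ite_mul, mul_one, one_mul, mul_zero, zero_mul, Finset.sum_ite_eq,
      Finset.sum_ite_eq', Finset.mem_univ, if_true, Finset.sum_const_zero]
    rw [hw k i, hw k j, hw l i, hw l j]
    ring
  have hlt : ∀ a b e f : Fin n, a ≠ b → a ≠ e → a ≠ f → b ≠ e → b ≠ f → e ≠ f →
      L a b = 1 / 2 → L a e < 1 / 2 := by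
    intro a b e f hab hae haf hbe hbf hef h
    have hr := T0.row_sum (σ a)
    have hsub : ({σ b, σ e, σ f} : Finset (Fin n)) ⊆ Finset.univ.erase (σ a) := by
      intro z hz
      simp only [Finset.mem_insert, Finset.mem_singleton] at hz
      simp only [Finset.mem_erase, Finset.mem_univ, and_true]
      rcases hz with rfl | rfl | rfl
      · exact fun h => hab (σ.injective h.symm)
      · exact fun h => hae (σ.injective h.symm)
      · exact fun h => haf (σ.injective h.symm)
    have hle := Finset.sum_le_sum_of_subset_of_nonneg (f := fun z => T0.lam (σ a) z) hsub
      (fun z _ _ => (T0.lam_pos _ _).le)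
    rw [Finset.sum_insert (by simp [hbe, hbf]), Finset.sum_insert (by simp [hef]),
      Finset.sum_singleton] at hle
    have hp := T0.lam_pos (σ a) (σ f)
    simp only [hL] at h ⊢
    have : ∑ z ∈ Finset.univ.erase (σ a), T0.lam (σ a) z = 1 := by
      convert hr
    linarith
  have L1 : L i k = 1 / 2 := by simp only [hL]; rw [s0, s1, hx1]
  have L2 : L j l = 1 / 2 := by simp only [hL]; rw [s2, s3, hx2]
  have L3 := hlt i k l j hik hil hij hkl hjk.symm hjl.symm L1
  have L4 := hlt k i j l hik.symm hjk.symm hkl hij hil hjl (by rw [hLs, L1])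
  rw [hLs k j] at L4
  rw [hsum2] at hsum
  rcases mul_eq_zero.mp hsum with h | h
  · linarith
  · linarith

lemma split_w {n : ℕ} (hn : 4 ≤ n) (w : Fin n → Fin n → ℝ) (hw : ∀ a b, w a b = w b a)
    (hq : ∀ i j k l : Fin n, i ≠ j → i ≠ k → i ≠ l → j ≠ k → j ≠ l → k ≠ l →
      w i k + w j l = w j k + w i l) :
    ∃ y : Fin n → ℝ, ∀ a b, a ≠ b → w a b = y a + y b := by
  obtain ⟨o, p, q, hop, hoq, hpq⟩ : ∃ o p q : Fin n, o ≠ p ∧ o ≠ q ∧ p ≠ q :=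
    ⟨⟨0, by omega⟩, ⟨1, by omega⟩, ⟨2, by omega⟩, by simp, by simp, by simp⟩
  set y0 := (w o p + w o q - w p q) / 2 with hy0
  refine ⟨fun a => if a = o then y0 else w o a - y0, ?_⟩
  intro a b hab
  by_cases ha : a = o
  · subst ha
    simp [hab.symm]
  by_cases hb : b = o
  · subst hb
    simp [hab, hw a]
  simp only [ha, hb, if_false]
  suffices w a b + w o p + w o q = w o a + w o b + w p q by rw [hy0]; linarith
  have key1 : ∀ b, b ≠ o → b ≠ p → b ≠ q → w p b + w o q = w o b + w p q := by
    intro b h1 h2 h3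
    have := hq p o b q hop.symm h2.symm hpq h1.symm hoq h3
    linarith
  have key2 : ∀ b, b ≠ o → b ≠ p → b ≠ q → w q b + w o p = w o b + w p q := by
    intro b h1 h2 h3
    have := hq q o b p hoq.symm h3.symm hpq.symm h1.symm hop h2
    rw [hw p q]
    linarith
  by_cases hap : a = p
  · subst hap
    by_cases hbq : b = q
    · subst hbq; linarith
    · have := key1 b hb hab.symm hbq; linarith
  by_cases hbp : b = p
  · subst hbp
    by_cases haq : a = q
    · subst haq; rw [hw a b]; linarith
    · have := key1 a ha hab haq; rw [hw a b]; linarith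
  by_cases haq : a = q
  · subst haq
    have := key2 b hb hbp hab.symm; linarith
  by_cases hbq : b = q
  · subst hbq
    have := key2 a ha hap hab; rw [hw a b]; linarith
  have e1 := hq a o b p ha hab hap (Ne.symm hb) hop hbp
  have e2 := key1 a ha hap haq
  rw [hw a p] at e1
  linarith

end LinAlg


lemma exists_func_ne {n : ℕ} {D : Submodule ℝ (LeafPairs n → ℝ)} {x : LeafPairs n → ℝ}
    (hx : x ∉ D) : ∃ f : (LeafPairs n → ℝ) →ₗ[ℝ] ℝ, f x ≠ 0 ∧ D ≤ LinearMap.ker f :=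
  Submodule.exists_le_ker_of_notMem hx

lemma vectorSpan_le_ker (n : ℕ) :
    vectorSpan ℝ {x : LeafPairs n → ℝ | ∃ T : PhyloTree n, T.IsBinary ∧ T.bmeVec = x}
      ≤ LinearMap.ker (rowMap n) := by
  rw [vectorSpan_def, Submodule.span_le]
  rintro _ ⟨_, ⟨T, -, rfl⟩, _, ⟨T', -, rfl⟩, rfl⟩
  simp [rowMap_bme]

lemma ker_le_vectorSpan (n : ℕ) (hn : 4 ≤ n) : LinearMap.ker (rowMap n) ≤
    vectorSpan ℝ {x : LeafPairs n → ℝ | ∃ T : PhyloTree n, T.IsBinary ∧ T.bmeVec = x} := by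
  intro x hx
  by_contra hxD
  obtain ⟨f, hfx, hle⟩ := exists_func_ne hxD
  apply hfx
  set w : Fin n → Fin n → ℝ := fun a b =>
    if h : a < b then f (Pi.single ⟨(a, b), h⟩ 1) else
    if h : b < a then f (Pi.single ⟨(b, a), h⟩ 1) else 0 with hwdef
  have hwp : ∀ p : LeafPairs n, w p.1.1 p.1.2 = f (Pi.single p 1) := by
    intro p
    simp only [hwdef]
    rw [dif_pos p.2]
  have hf : ∀ z, f z = ∑ p : LeafPairs n, w p.1.1 p.1.2 * z p := by
    intro z
    conv_lhs => rw [LinearMap.pi_apply_eq_sum_univ f z]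
    apply Finset.sum_congr rfl
    intro p _
    rw [smul_eq_mul, mul_comm, hwp]
    congr 2
    funext q
    simp [Pi.single_apply, eq_comm]
  have hw : ∀ a b, w a b = w b a := by
    intro a b
    simp only [hwdef]
    rcases lt_trichotomy a b with h | h | h
    · simp [h, h.not_gt]
    · simp [h]
    · simp [h, h.not_gt]
  have hd : ∀ a, w a a = 0 := by
    intro a
    simp [hwdef]
  obtain ⟨T0, hT0, -⟩ := exists_two_cherries n hn
  have hc : ∀ T : PhyloTree n, T.IsBinary →
      ∑ p : LeafPairs n, w p.1.1 p.1.2 * T.bmeVec p = f T0.bmeVec := by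
    intro T hT
    rw [← hf]
    have : f (T.bmeVec -ᵥ T0.bmeVec) = 0 :=
      hle (vsub_mem_vectorSpan ℝ ⟨T, hT, rfl⟩ ⟨T0, hT0, rfl⟩)
    rw [vsub_eq_sub, map_sub] at this
    linarith
  obtain ⟨y, hy⟩ := split_w hn w hw (quad hn w hw _ hc hd)
  have : ∑ a, y a * rowMap n x a = 0 := by
    rw [LinearMap.mem_ker.mp hx]
    simp
  rw [hf, ← this, rowMap_dual]
  apply Finset.sum_congr rfl
  intro p _
  rw [hy _ _ p.2.ne]

/-- For `n ≥ 3`, the affine span of the BME vectors of all binary phylogenetic trees on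
leaf set `{1,…,n}` has dimension `C(n,2) - n`; that is, the BME polytope lies in
`ℝ^{C(n,2)}` and has dimension `C(n,2) - n`. -/
theorem bme_polytope_dimension (n : ℕ) (hn : 3 ≤ n) :
    Module.finrank ℝ
      (affineSpan ℝ {x : LeafPairs n → ℝ | ∃ T : PhyloTree n, T.IsBinary ∧ T.bmeVec = x}).direction
      = n.choose 2 - n := by
  have hk := LinearMap.finrank_range_add_finrank_ker (rowMap n)
  rw [rowMap_range n hn, finrank_top, Module.finrank_fintype_fun_eq_card, Fintype.card_fin,
    Module.finrank_fintype_fun_eq_card, card_leafPairs] at hk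
  rw [direction_affineSpan]
  rcases Nat.lt_or_ge n 4 with h4 | h4
  · have hle := Submodule.finrank_mono (vectorSpan_le_ker n)
    have : n = 3 := by omega
    subst this
    have h3 : Nat.choose 3 2 = 3 := rfl
    omega
  · rw [le_antisymm (vectorSpan_le_ker n) (ker_le_vectorSpan n h4)]
    omega
end

section
/- The neighbor-joining cones for 5 taxa do not form a fan: the intersection C_{23,45} ∩ C_{12,34} is not an extreme subset (not a face) of the cone C_{12,34}. Consequently, the collection of NJ cones for 5 taxa is not the collection of cones of any polyhedral fan, and in particular is not the normal fan of any polytope. -/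
/-- Identify a vector `x ∈ ℝ^{10}` with coordinates `(d12, d13, d14, d15, d23, d24,
d25, d34, d35, d45)` with the corresponding symmetric dissimilarity matrix on 5 taxa. -/
noncomputable def toMat (x : Fin 10 → ℝ) : Fin 5 → Fin 5 → ℝ := fun i j =>
  !![0,   x 0, x 1, x 2, x 3;
     x 0, 0,   x 4, x 5, x 6;
     x 1, x 4, 0,   x 7, x 8;
     x 2, x 5, x 7, 0,   x 9;
     x 3, x 6, x 8, x 9, 0  ] i j

/-- The (first round) Q-criterion `q_{ij}(d) = 3 d_{ij} - Σ_k d_{ik} - Σ_k d_{kj}`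
for 5 taxa. -/
noncomputable def Qcrit (x : Fin 10 → ℝ) (i j : Fin 5) : ℝ :=
  3 * toMat x i j - (∑ k, toMat x i k) - ∑ k, toMat x k j

/-- The reduced dissimilarity map after joining the pair `{a, b}` into a new node `z`,
modelled on `Option (Fin 5)` with `none` playing the role of `z`:
`d'_{zk} = (d_{ak} + d_{bk} - d_{ab})/2` and `d'_{jk} = d_{jk}` for `j, k ∉ {a, b}`. -/
noncomputable def redD (x : Fin 10 → ℝ) (a b : Fin 5) :
    Option (Fin 5) → Option (Fin 5) → ℝ
  | some j, some k => toMat x j k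
  | none, some k => (toMat x a k + toMat x b k - toMat x a b) / 2
  | some j, none => (toMat x j a + toMat x j b - toMat x a b) / 2
  | none, none => 0

/-- The reduced taxon set after joining the pair `{a, b}`: the new node `z = none`
together with the taxa different from `a` and `b`. -/
def redTaxa (a b : Fin 5) : Finset (Option (Fin 5)) :=
  insert none ((((Finset.univ : Finset (Fin 5)).erase a).erase b).image some)

/-- The second-round Q-criterion on the reduced taxon set:
`q'_{uv}(d') = 2 d'_{uv} - Σ_k d'_{uk} - Σ_k d'_{kv}`, sums over the four reduced taxa. -/
noncomputable def Qcrit' (x : Fin 10 → ℝ) (a b : Fin 5) (u v : Option (Fin 5)) : ℝ :=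
  2 * redD x a b u v - (∑ k ∈ redTaxa a b, redD x a b u k)
    - ∑ k ∈ redTaxa a b, redD x a b k v

/-- The neighbor-joining cone `C_{ab,cd} ⊆ ℝ^{10}`: the set of dissimilarity maps `x`
such that `q_{ab}(x) ≤ q_{ij}(x)` for all pairs `{i,j}` of `{1,…,5}`, and, in the
reduced data after joining `{a,b}`, `q'_{cd} ≤ q'_{uv}` for all pairs `{u,v}` of the
four reduced taxa.  On the interior of this cone, neighbor-joining first joins the
cherry `{a,b}` and then the cherry `{c,d}`. -/
noncomputable def NJcone (a b c d : Fin 5) : Set (Fin 10 → ℝ) :=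
  {x | (∀ i j : Fin 5, i ≠ j → Qcrit x a b ≤ Qcrit x i j) ∧
       (∀ u ∈ redTaxa a b, ∀ v ∈ redTaxa a b, u ≠ v →
          Qcrit' x a b (some c) (some d) ≤ Qcrit' x a b u v)}

set_option maxHeartbeats 4000000 in
/-- The neighbor-joining cones for 5 taxa do not form a fan: the intersection
`C_{23,45} ∩ C_{12,34}` is not an extreme subset (not a face) of the cone `C_{12,34}`
(taxa `1,…,5` encoded as `0,…,4 : Fin 5`).  Consequently the collection of NJ cones for
5 taxa is not the collection of cones of any polyhedral fan, and in particular is not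
the normal fan of any polytope. -/
theorem nj_cones_not_a_fan :
    ¬ IsExtreme ℝ (NJcone 0 1 2 3) (NJcone 1 2 3 4 ∩ NJcone 0 1 2 3) := by
  have h01 : redTaxa 0 1 = {none, some 2, some 3, some 4} := by decide
  have h12 : redTaxa 1 2 = {none, some 0, some 3, some 4} := by decide
  have hx : (![0, 1, 0, 0, 0, 1, 0, 0, 0, 0] : Fin 10 → ℝ) ∈ NJcone 0 1 2 3 := by
    simp [NJcone, Qcrit', h01, Qcrit, toMat, redD, Fin.forall_fin_succ, Fin.sum_univ_succ]
    try norm_num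
  have hy : (![0, 7, 2, 0, 0, 7, 4, 0, 2, 0] : Fin 10 → ℝ) ∈ NJcone 0 1 2 3 := by
    simp [NJcone, Qcrit', h01, Qcrit, toMat, redD, Fin.forall_fin_succ, Fin.sum_univ_succ]
    try norm_num
  have hp : (![0, 4, 1, 0, 0, 4, 2, 0, 1, 0] : Fin 10 → ℝ) ∈ NJcone 0 1 2 3 := by
    simp [NJcone, Qcrit', h01, Qcrit, toMat, redD, Fin.forall_fin_succ, Fin.sum_univ_succ]
    try norm_num
  have hp' : (![0, 4, 1, 0, 0, 4, 2, 0, 1, 0] : Fin 10 → ℝ) ∈ NJcone 1 2 3 4 := by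
    simp [NJcone, Qcrit', h12, Qcrit, toMat, redD, Fin.forall_fin_succ, Fin.sum_univ_succ]
    try norm_num
  have hx' : (![0, 1, 0, 0, 0, 1, 0, 0, 0, 0] : Fin 10 → ℝ) ∉ NJcone 1 2 3 4 := by
    intro hc
    have := hc.2 none (by simp [h12]) (some 3) (by simp [h12]) (by simp)
    have h2 := hc.2 none (by simp [h12]) (some 4) (by simp [h12]) (by simp)
    simp [Qcrit', h12, toMat, redD] at this h2
    linarith
  intro h
  refine hx' (h.2 hx hy ⟨hp', hp⟩ ?_).1
  refine ⟨1 / 2, 1 / 2, by norm_num, by norm_num, by norm_num, ?_⟩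
  ext i
  fin_cases i <;> simp <;> norm_num
end

section
/- The lineality space of the neighbor-joining cone C_{12,45} ⊂ ℝ^{10} is spanned by the shift vectors: {x ∈ ℝ^{10} : x ∈ C_{12,45} and −x ∈ C_{12,45}} equals the linear span of the five shift vectors s_1, …, s_5. -/
/-- The list of unordered pairs of taxa indexing the coordinates
`d12, d13, d14, d15, d23, d24, d25, d34, d35, d45` of `ℝ^{10}`. -/
def pairIdx : Fin 10 → Fin 5 × Fin 5 :=
  ![(0, 1), (0, 2), (0, 3), (0, 4), (1, 2), (1, 3), (1, 4), (2, 3), (2, 4), (3, 4)]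

/-- The shift vector of taxon `a`, as a vector in `ℝ^{10}`: the dissimilarity map in
which `a` is at distance 1 from all other taxa and all other distances are 0. -/
noncomputable def shiftVec (a : Fin 5) : Fin 10 → ℝ :=
  fun p => if (pairIdx p).1 = a ∨ (pairIdx p).2 = a then 1 else 0

lemma toMat_neg' (x : Fin 10 → ℝ) (i j : Fin 5) : toMat (-x) i j = - toMat x i j := by
  fin_cases i <;> fin_cases j <;> simp [toMat]

lemma Qcrit_neg' (x : Fin 10 → ℝ) (i j : Fin 5) : Qcrit (-x) i j = - Qcrit x i j := by
  simp only [Qcrit, toMat_neg', Finset.sum_neg_distrib]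
  ring

/-- The dissimilarity map of a combination of shift vectors. -/
lemma toMat_shift (c : Fin 5 → ℝ) (i j : Fin 5) :
    toMat (∑ a, c a • shiftVec a) i j = if i = j then 0 else c i + c j := by
  fin_cases i <;> fin_cases j <;>
    simp [toMat, shiftVec, pairIdx, Fin.sum_univ_five] <;> ring

lemma Qcrit_shift (c : Fin 5 → ℝ) (i j : Fin 5) (h : i ≠ j) :
    Qcrit (∑ a, c a • shiftVec a) i j = -2 * ∑ a, c a := by
  simp only [Qcrit, toMat_shift]
  revert h
  fin_cases i <;> fin_cases j <;> simp [Fin.sum_univ_five] <;> ring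

lemma redTaxa_eq : redTaxa 0 1 = {none, some 2, some 3, some 4} := by decide

lemma Qcrit'_shift (c : Fin 5 → ℝ) (u v : Option (Fin 5))
    (hu : u ∈ redTaxa 0 1) (hv : v ∈ redTaxa 0 1) (h : u ≠ v) :
    Qcrit' (∑ a, c a • shiftVec a) 0 1 u v = -2 * (c 2 + c 3 + c 4) := by
  simp only [Qcrit', redTaxa_eq] at *
  simp only [Finset.mem_insert, Finset.mem_singleton] at hu hv
  rcases hu with rfl | rfl | rfl | rfl <;> rcases hv with rfl | rfl | rfl | rfl <;>
    first
    | exact absurd rfl h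
    | (simp [redD, toMat_shift]; ring)

lemma shift_mem (c : Fin 5 → ℝ) : (∑ a, c a • shiftVec a) ∈ NJcone 0 1 3 4 := by
  constructor
  · intro i j h
    rw [Qcrit_shift c i j h, Qcrit_shift c 0 1 (by decide)]
  · intro u hu v hv h
    rw [Qcrit'_shift c u v hu hv h,
      Qcrit'_shift c _ _ (by decide) (by decide) (by decide)]

/-- The lineality space of the neighbor-joining cone `C_{12,45}` is spanned by the
shift vectors: `{x : x ∈ C_{12,45} and -x ∈ C_{12,45}}` equals the linear span of
`s_1, …, s_5` (taxa `1,…,5` encoded as `0,…,4 : Fin 5`). -/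
theorem nj_cone_lineality_space :
    {x : Fin 10 → ℝ | x ∈ NJcone 0 1 3 4 ∧ -x ∈ NJcone 0 1 3 4}
      = ↑(Submodule.span ℝ (Set.range shiftVec)) := by
  ext x
  simp only [Set.mem_ofPred_eq, SetLike.mem_coe, Submodule.mem_span_range_iff_exists_fun]
  constructor
  · rintro ⟨⟨h1, -⟩, ⟨h2, -⟩⟩
    have key : ∀ i j : Fin 5, i ≠ j → Qcrit x i j = Qcrit x 0 1 := by
      intro i j h
      have a := h1 i j h
      have b := h2 i j h
      rw [Qcrit_neg', Qcrit_neg'] at b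
      linarith
    refine ⟨fun i => (∑ k, toMat x i k) / 3 + Qcrit x 0 1 / 6, ?_⟩
    have e : ∀ i j : Fin 5, i ≠ j →
        toMat x i j = ((∑ k, toMat x i k) / 3 + Qcrit x 0 1 / 6)
          + ((∑ k, toMat x j k) / 3 + Qcrit x 0 1 / 6) := by
      intro i j h
      have a := key i j h
      have s : ∑ k, toMat x k j = ∑ k, toMat x j k :=
        Finset.sum_congr rfl fun k _ => by
          fin_cases k <;> fin_cases j <;> simp [toMat]
      rw [Qcrit, s] at a
      linarith
    set c : Fin 5 → ℝ := fun i => (∑ k, toMat x i k) / 3 + Qcrit x 0 1 / 6 with hc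
    have e' : ∀ i j : Fin 5, i ≠ j →
        toMat (∑ a, c a • shiftVec a) i j = toMat x i j := by
      intro i j h
      rw [toMat_shift, if_neg h]
      exact (e i j h).symm
    funext p
    have hp : ∀ (y : Fin 10 → ℝ), toMat y (pairIdx p).1 (pairIdx p).2 = y p := by
      intro y
      fin_cases p <;> simp [toMat, pairIdx]
    rw [← hp (∑ a, c a • shiftVec a), ← hp x]
    exact e' _ _ (by clear hp; revert p; decide)
  · rintro ⟨c, rfl⟩
    refine ⟨shift_mem c, ?_⟩
    have := shift_mem (-c)
    simpa [Finset.sum_neg_distrib] using this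
end

section
/- For all real numbers α ≥ β > 0 and every dissimilarity map D ∈ ℝ^{10} with ‖D − D_T(α, β)‖₂ < β/√3, the map D lies in C_{12,45} ∪ C_{45,12}; that is, any dissimilarity map within l₂ distance β/√3 of the tree metric D_T(α,β) is one for which neighbor-joining outputs the correct tree topology (cherries {1,2} and {4,5}). -/
/-- The tree metric `D_T(α, β)` of the 5-leaf binary tree with cherries `{1,2}` and
`{4,5}`, internal edge lengths `α` and `β`, and zero leaf edge lengths, in coordinates
`d12, d13, d14, d15, d23, d24, d25, d34, d35, d45`. -/
noncomputable def treeMetric (α β : ℝ) : Fin 10 → ℝ :=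
  ![0, α, α + β, α + β, α, α + β, α + β, β, β, 0]


theorem cs_aux (β : ℝ) (hb : 0 < β) (c e : Fin 10 → ℝ) (hc : ∑ i, c i ^ 2 ≤ 12)
    (he : ∑ i, e i ^ 2 < β ^ 2 / 3) : ∑ i, c i * e i ≤ 2 * β := by
  have h := Finset.sum_mul_sq_le_sq_mul_sq Finset.univ c e
  have h0 : 0 ≤ ∑ i, e i ^ 2 := Finset.sum_nonneg fun i _ => sq_nonneg _
  refine abs_le_of_sq_le_sq' ?_ (by positivity) |>.2
  nlinarith

set_option maxHeartbeats 2000000 in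
/-- For all `α ≥ β > 0`, every dissimilarity map `D ∈ ℝ^{10}` whose Euclidean (`l₂`)
distance from the tree metric `D_T(α, β)` is less than `β/√3` lies in
`C_{12,45} ∪ C_{45,12}` (taxa `1,…,5` encoded as `0,…,4 : Fin 5`); that is,
neighbor-joining outputs the correct tree topology (cherries `{1,2}` and `{4,5}`)
on any such `D`. -/
theorem nj_correct_within_l2_radius (α β : ℝ) (hba : β ≤ α) (hb : 0 < β)
    (D : Fin 10 → ℝ)
    (hD : Real.sqrt (∑ i, (D i - treeMetric α β i) ^ 2) < β / Real.sqrt 3) :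
    D ∈ NJcone 0 1 3 4 ∪ NJcone 3 4 0 1 := by
  have he : ∑ i, (D i - treeMetric α β i) ^ 2 < β ^ 2 / 3 := by
    have h3 : β / Real.sqrt 3 = Real.sqrt (β ^ 2 / 3) := by
      rw [Real.sqrt_div (sq_nonneg β), Real.sqrt_sq hb.le]
    rw [h3] at hD
    exact (Real.sqrt_lt_sqrt_iff (Finset.sum_nonneg fun i _ => sq_nonneg _)).1 hD
  have key : ∀ c0 c1 c2 c3 c4 c5 c6 c7 c8 c9 : ℝ,
      c0^2 + c1^2 + c2^2 + c3^2 + c4^2 + c5^2 + c6^2 + c7^2 + c8^2 + c9^2 ≤ 12 →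
      c0 * D 0 + c1 * (D 1 - α) + c2 * (D 2 - (α + β)) + c3 * (D 3 - (α + β))
        + c4 * (D 4 - α) + c5 * (D 5 - (α + β)) + c6 * (D 6 - (α + β))
        + c7 * (D 7 - β) + c8 * (D 8 - β) + c9 * D 9 ≤ 2 * β := by
    intro c0 c1 c2 c3 c4 c5 c6 c7 c8 c9 hc
    have h := cs_aux β hb ![c0, c1, c2, c3, c4, c5, c6, c7, c8, c9]
      (fun i => D i - treeMetric α β i)
      (by simp [Fin.sum_univ_succ]; linarith) he
    simp [Fin.sum_univ_succ, treeMetric] at h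
    have e2 : (Fin.succ 1 : Fin 10) = 2 := rfl
    linarith
  rcases le_total (Qcrit D 0 1) (Qcrit D 3 4) with hq | hq
  · left
    have h02 := key (2) (-2) (0) (0) (0) (-1) (-1) (1) (1) (0) (by norm_num)
    have h03 := key (2) (0) (-2) (0) (-1) (0) (-1) (1) (0) (1) (by norm_num)
    have h04 := key (2) (0) (0) (-2) (-1) (-1) (0) (0) (1) (1) (by norm_num)
    have h12 := key (2) (0) (-1) (-1) (-2) (0) (0) (1) (1) (0) (by norm_num)
    have h13 := key (2) (-1) (0) (-1) (0) (-2) (0) (1) (0) (1) (by norm_num)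
    have h14 := key (2) (-1) (-1) (0) (0) (0) (-2) (0) (1) (1) (by norm_num)
    have h23 := key (1) (0) (0) (-1) (0) (0) (-1) (-1) (1) (1) (by norm_num)
    have h24 := key (1) (0) (-1) (0) (0) (-1) (0) (1) (-1) (1) (by norm_num)
    have g3 := key (0) (1/2) (0) (-1/2) (1/2) (0) (-1/2) (-1) (0) (1) (by norm_num)
    have g4 := key (0) (1/2) (-1/2) (0) (1/2) (-1/2) (0) (0) (-1) (1) (by norm_num)
    have hT : redTaxa 0 1 = {none, some 2, some 3, some 4} := by decide
    refine ⟨?_, ?_⟩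
    · intro i j hij
      fin_cases i <;> fin_cases j <;> first
        | exact absurd rfl hij
        | (simp [Qcrit, toMat, Fin.sum_univ_five] at hq ⊢ <;> linarith)
    · intro u hu v hv huv
      simp only [Qcrit', hT] at hu hv ⊢
      simp only [Finset.mem_insert, Finset.mem_singleton] at hu hv
      rcases hu with rfl | rfl | rfl | rfl <;> rcases hv with rfl | rfl | rfl | rfl <;> first
        | exact absurd rfl huv
        | (simp [redD, toMat] <;> linarith)
  · right
    have h02 := key (1) (-1) (0) (0) (1) (-1) (-1) (0) (0) (1) (by norm_num)
    have h03 := key (1) (1) (-2) (0) (0) (0) (-1) (0) (-1) (2) (by norm_num)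
    have h04 := key (1) (1) (0) (-2) (0) (-1) (0) (-1) (0) (2) (by norm_num)
    have h12 := key (1) (1) (-1) (-1) (-1) (0) (0) (0) (0) (1) (by norm_num)
    have h13 := key (1) (0) (0) (-1) (1) (-2) (0) (0) (-1) (2) (by norm_num)
    have h14 := key (1) (0) (-1) (0) (1) (0) (-2) (-1) (0) (2) (by norm_num)
    have h23 := key (0) (1) (0) (-1) (1) (0) (-1) (-2) (0) (2) (by norm_num)
    have h24 := key (0) (1) (-1) (0) (1) (-1) (0) (0) (-2) (2) (by norm_num)
    have g0 := key (1) (-1) (0) (0) (0) (-1/2) (-1/2) (1/2) (1/2) (0) (by norm_num)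
    have g1 := key (1) (0) (-1/2) (-1/2) (-1) (0) (0) (1/2) (1/2) (0) (by norm_num)
    have hT : redTaxa 3 4 = {none, some 2, some 0, some 1} := by decide
    refine ⟨?_, ?_⟩
    · intro i j hij
      fin_cases i <;> fin_cases j <;> first
        | exact absurd rfl hij
        | (simp [Qcrit, toMat, Fin.sum_univ_five] at hq ⊢ <;> linarith)
    · intro u hu v hv huv
      simp only [Qcrit', hT] at hu hv ⊢
      simp only [Finset.mem_insert, Finset.mem_singleton] at hu hv
      rcases hu with rfl | rfl | rfl | rfl <;> rcases hv with rfl | rfl | rfl | rfl <;> first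
        | exact absurd rfl huv
        | (simp [redD, toMat] <;> linarith)
end

section
/- There exist symmetric 5×5 real matrices f and g with zero diagonal and all off-diagonal entries in the open interval (0, 3/4) such that, letting JC(x)_{ij} = −(3/4)·ln(1 − (4/3)·x_{ij}) denote the Jukes–Cantor correction applied entrywise, the corrected dissimilarity map D₁ = JC(f) lies in the NJ cone C_{12,45}, D₂ = JC(g) lies in C_{45,12}, and D₃ = JC((f+g)/2) lies in C_{24,15}. Consequently neighbor-joining outputs the same tree topology (cherries {1,2} and {4,5}) for both D₁ and D₂, but a different tree topology (with cherry {2,4}) for the dissimilarity map obtained from the combined (concatenated) data. -/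
/-- The vector in `ℝ^{10}` of off-diagonal entries of a symmetric `5 × 5` matrix. -/
noncomputable def vecOf (d : Fin 5 → Fin 5 → ℝ) : Fin 10 → ℝ :=
  fun p => d (pairIdx p).1 (pairIdx p).2

/-- The Jukes–Cantor correction `x ↦ -(3/4) ln(1 - (4/3) x)`. -/
noncomputable def jcCorrect (x : ℝ) : ℝ := -(3 / 4) * Real.log (1 - (4 / 3) * x)


lemma jc_eq (u L : ℝ) (h : Real.log u = -L) : jcCorrect ((3/4) * (1 - u)) = (3/4) * L := by
  unfold jcCorrect
  rw [show 1 - 4/3 * ((3/4) * (1 - u)) = u by ring, h]; ring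

lemma log_rep (n k l : ℕ) : Real.log (3 ^ k * 11 ^ l / 2 ^ n) =
    -(n * Real.log 2 - k * Real.log 3 - l * Real.log 11) := by
  rw [Real.log_div (by positivity) (by positivity), Real.log_mul (by positivity) (by positivity),
    Real.log_pow, Real.log_pow, Real.log_pow]
  ring

lemma jc_rep (x : ℝ) (n k l : ℕ) (h : x = (3/4) * (1 - 3 ^ k * 11 ^ l / 2 ^ n)) :
    jcCorrect x = (3/4) * (n * Real.log 2 - k * Real.log 3 - l * Real.log 11) := by
  rw [h]; exact jc_eq _ _ (log_rep n k l)

lemma log_bounds : 19 * Real.log 2 < 12 * Real.log 3 ∧ 5 * Real.log 3 < 8 * Real.log 2 ∧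
    10 * Real.log 2 < 3 * Real.log 11 ∧ 2 * Real.log 11 < 7 * Real.log 2 := by
  have key : ∀ (p q : ℝ) (m n : ℕ), 0 < p → 0 < q → p ^ m < q ^ n →
      (m : ℝ) * Real.log p < n * Real.log q := by
    intro p q m n hp hq h
    rw [← Real.log_pow, ← Real.log_pow]
    exact Real.log_lt_log (by positivity) h
  refine ⟨?_, ?_, ?_, ?_⟩
  · exact_mod_cast key 2 3 19 12 (by norm_num) (by norm_num) (by norm_num)
  · exact_mod_cast key 3 2 5 8 (by norm_num) (by norm_num) (by norm_num)
  · exact_mod_cast key 2 11 10 3 (by norm_num) (by norm_num) (by norm_num)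
  · exact_mod_cast key 11 2 2 7 (by norm_num) (by norm_num) (by norm_num)

noncomputable def fVec : Fin 10 → ℝ :=
  ![(3/4) * (1 - 1/2), (3/4) * (1 - 1/2), (3/4) * (1 - 1/16), (3/4) * (1 - 1/4), (3/4) * (1 - 1/16), (3/4) * (1 - 1/64), (3/4) * (1 - 1/64), (3/4) * (1 - 1/16), (3/4) * (1 - 1/8), (3/4) * (1 - 1/32)]

noncomputable def gVec : Fin 10 → ℝ :=
  ![(3/4) * (1 - 1/2), (3/4) * (1 - 1/4), (3/4) * (1 - 1/32), (3/4) * (1 - 1/32), (3/4) * (1 - 1/2), (3/4) * (1 - 1/2), (3/4) * (1 - 1/32), (3/4) * (1 - 1/8), (3/4) * (1 - 1/16), (3/4) * (1 - 1/16)]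

lemma cone_f :
    (![(3/4) * (1 * Real.log 2), (3/4) * (1 * Real.log 2), (3/4) * (4 * Real.log 2), (3/4) * (2 * Real.log 2), (3/4) * (4 * Real.log 2), (3/4) * (6 * Real.log 2), (3/4) * (6 * Real.log 2), (3/4) * (4 * Real.log 2), (3/4) * (3 * Real.log 2), (3/4) * (5 * Real.log 2)] : Fin 10 → ℝ) ∈ NJcone 0 1 3 4 := by
  have h2 : 0 < Real.log 2 := Real.log_pos (by norm_num)
  have hT : redTaxa 0 1 = {none, some 2, some 3, some 4} := by decide
  refine ⟨?_, ?_⟩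
  · intro i j hij
    fin_cases i <;> fin_cases j <;> first
      | exact absurd rfl hij
      | (simp [Qcrit, toMat, Fin.sum_univ_succ]; try linarith)
  · intro u hu v hv huv
    simp only [Qcrit', hT] at *
    simp only [Finset.mem_insert, Finset.mem_singleton] at hu hv
    rcases hu with rfl | rfl | rfl | rfl <;> rcases hv with rfl | rfl | rfl | rfl <;> first
      | exact absurd rfl huv
      | (simp [redD, toMat]; try linarith)

lemma cone_g :
    (![(3/4) * (1 * Real.log 2), (3/4) * (2 * Real.log 2), (3/4) * (5 * Real.log 2), (3/4) * (5 * Real.log 2), (3/4) * (1 * Real.log 2), (3/4) * (1 * Real.log 2), (3/4) * (5 * Real.log 2), (3/4) * (3 * Real.log 2), (3/4) * (4 * Real.log 2), (3/4) * (4 * Real.log 2)] : Fin 10 → ℝ) ∈ NJcone 3 4 0 1 := by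
  have h2 : 0 < Real.log 2 := Real.log_pos (by norm_num)
  have hT : redTaxa 3 4 = {none, some 0, some 1, some 2} := by decide
  refine ⟨?_, ?_⟩
  · intro i j hij
    fin_cases i <;> fin_cases j <;> first
      | exact absurd rfl hij
      | (simp [Qcrit, toMat, Fin.sum_univ_succ]; try linarith)
  · intro u hu v hv huv
    simp only [Qcrit', hT] at *
    simp only [Finset.mem_insert, Finset.mem_singleton] at hu hv
    rcases hu with rfl | rfl | rfl | rfl <;> rcases hv with rfl | rfl | rfl | rfl <;> first
      | exact absurd rfl huv
      | (simp [redD, toMat]; try linarith)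

lemma cone_fg :
    (![(3/4) * (1 * Real.log 2 - 0 * Real.log 3 - 0 * Real.log 11),
      (3/4) * (3 * Real.log 2 - 1 * Real.log 3 - 0 * Real.log 11),
      (3/4) * (6 * Real.log 2 - 1 * Real.log 3 - 0 * Real.log 11),
      (3/4) * (6 * Real.log 2 - 2 * Real.log 3 - 0 * Real.log 11),
      (3/4) * (5 * Real.log 2 - 2 * Real.log 3 - 0 * Real.log 11),
      (3/4) * (7 * Real.log 2 - 1 * Real.log 3 - 1 * Real.log 11),
      (3/4) * (7 * Real.log 2 - 1 * Real.log 3 - 0 * Real.log 11),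
      (3/4) * (5 * Real.log 2 - 1 * Real.log 3 - 0 * Real.log 11),
      (3/4) * (5 * Real.log 2 - 1 * Real.log 3 - 0 * Real.log 11),
      (3/4) * (6 * Real.log 2 - 1 * Real.log 3 - 0 * Real.log 11)] : Fin 10 → ℝ) ∈ NJcone 1 3 0 4 := by
  have h2 : 0 < Real.log 2 := Real.log_pos (by norm_num)
  obtain ⟨h3, h3', h11, h11'⟩ := log_bounds
  have hT : redTaxa 1 3 = {none, some 0, some 2, some 4} := by decide
  refine ⟨?_, ?_⟩
  · intro i j hij
    fin_cases i <;> fin_cases j <;> first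
      | exact absurd rfl hij
      | (simp [Qcrit, toMat, Fin.sum_univ_succ]; try linarith)
  · intro u hu v hv huv
    simp only [Qcrit', hT] at *
    simp only [Finset.mem_insert, Finset.mem_singleton] at hu hv
    rcases hu with rfl | rfl | rfl | rfl <;> rcases hv with rfl | rfl | rfl | rfl <;> first
      | exact absurd rfl huv
      | (simp [redD, toMat]; try linarith)

lemma toMat_symm (x : Fin 10 → ℝ) (i j : Fin 5) : toMat x i j = toMat x j i := by
  fin_cases i <;> fin_cases j <;> rfl

lemma toMat_diag (x : Fin 10 → ℝ) (i : Fin 5) : toMat x i i = 0 := by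
  fin_cases i <;> rfl

lemma toMat_mem (x : Fin 10 → ℝ) (S : Set ℝ) (h : ∀ p, x p ∈ S) (i j : Fin 5) (hij : i ≠ j) :
    toMat x i j ∈ S := by
  fin_cases i <;> fin_cases j <;> first
    | exact absurd rfl hij
    | exact h _

lemma vec_apply (F : ℝ → ℝ → ℝ) (x y : Fin 10 → ℝ) :
    vecOf (fun i j => if i = j then 0 else F (toMat x i j) (toMat y i j)) =
      fun p => F (x p) (y p) := by
  funext p
  fin_cases p <;> rfl

/-- There exist symmetric mismatch-frequency matrices `f` and `g` (zero diagonal,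
off-diagonal entries in `(0, 3/4)`) such that the Jukes–Cantor corrected dissimilarity
map of `f` lies in the NJ cone `C_{12,45}`, that of `g` lies in `C_{45,12}`, yet that
of the combined data `(f+g)/2` lies in `C_{24,15}` (taxa `1,…,5` encoded as
`0,…,4 : Fin 5`).  Thus neighbor-joining outputs the tree with cherries `{1,2}` and
`{4,5}` for both individual data sets, but a different tree topology (with cherry
`{2,4}`) for the concatenated data. -/
theorem jukes_cantor_concatenation_paradox :
    ∃ f g : Fin 5 → Fin 5 → ℝ,
      (∀ i j, f i j = f j i) ∧ (∀ i, f i i = 0) ∧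
      (∀ i j, i ≠ j → f i j ∈ Set.Ioo (0 : ℝ) (3 / 4)) ∧
      (∀ i j, g i j = g j i) ∧ (∀ i, g i i = 0) ∧
      (∀ i j, i ≠ j → g i j ∈ Set.Ioo (0 : ℝ) (3 / 4)) ∧
      vecOf (fun i j => if i = j then 0 else jcCorrect (f i j)) ∈ NJcone 0 1 3 4 ∧
      vecOf (fun i j => if i = j then 0 else jcCorrect (g i j)) ∈ NJcone 3 4 0 1 ∧
      vecOf (fun i j => if i = j then 0 else jcCorrect ((f i j + g i j) / 2))
        ∈ NJcone 1 3 0 4 := by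
  refine ⟨toMat fVec, toMat gVec, toMat_symm _, toMat_diag _, toMat_mem _ _ ?_, toMat_symm _,
    toMat_diag _, toMat_mem _ _ ?_, ?_, ?_, ?_⟩
  · intro p
    fin_cases p <;> norm_num [fVec]
  · intro p
    fin_cases p <;> norm_num [gVec]
  · have h := vec_apply (fun s t => jcCorrect s) fVec gVec
    have e : (fun p => jcCorrect (fVec p)) = (![(3/4) * (1 * Real.log 2), (3/4) * (1 * Real.log 2), (3/4) * (4 * Real.log 2), (3/4) * (2 * Real.log 2), (3/4) * (4 * Real.log 2), (3/4) * (6 * Real.log 2), (3/4) * (6 * Real.log 2), (3/4) * (4 * Real.log 2), (3/4) * (3 * Real.log 2), (3/4) * (5 * Real.log 2)] : Fin 10 → ℝ) := by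
      funext p
      fin_cases p
      · refine (jc_rep _ 1 0 0 ?_).trans ?_ <;> norm_num [fVec, gVec]
      · refine (jc_rep _ 1 0 0 ?_).trans ?_ <;> norm_num [fVec, gVec]
      · refine (jc_rep _ 4 0 0 ?_).trans ?_ <;> norm_num [fVec, gVec]
      · refine (jc_rep _ 2 0 0 ?_).trans ?_ <;> norm_num [fVec, gVec]
      · refine (jc_rep _ 4 0 0 ?_).trans ?_ <;> norm_num [fVec, gVec]
      · refine (jc_rep _ 6 0 0 ?_).trans ?_ <;> norm_num [fVec, gVec]
      · refine (jc_rep _ 6 0 0 ?_).trans ?_ <;> norm_num [fVec, gVec]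
      · refine (jc_rep _ 4 0 0 ?_).trans ?_ <;> norm_num [fVec, gVec]
      · refine (jc_rep _ 3 0 0 ?_).trans ?_ <;> norm_num [fVec, gVec]
      · refine (jc_rep _ 5 0 0 ?_).trans ?_ <;> norm_num [fVec, gVec]
    have h' := h.trans e
    rw [h']
    exact cone_f
  · have h := vec_apply (fun s t => jcCorrect t) fVec gVec
    have e : (fun p => jcCorrect (gVec p)) = (![(3/4) * (1 * Real.log 2), (3/4) * (2 * Real.log 2), (3/4) * (5 * Real.log 2), (3/4) * (5 * Real.log 2), (3/4) * (1 * Real.log 2), (3/4) * (1 * Real.log 2), (3/4) * (5 * Real.log 2), (3/4) * (3 * Real.log 2), (3/4) * (4 * Real.log 2), (3/4) * (4 * Real.log 2)] : Fin 10 → ℝ) := by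
      funext p
      fin_cases p
      · refine (jc_rep _ 1 0 0 ?_).trans ?_ <;> norm_num [fVec, gVec]
      · refine (jc_rep _ 2 0 0 ?_).trans ?_ <;> norm_num [fVec, gVec]
      · refine (jc_rep _ 5 0 0 ?_).trans ?_ <;> norm_num [fVec, gVec]
      · refine (jc_rep _ 5 0 0 ?_).trans ?_ <;> norm_num [fVec, gVec]
      · refine (jc_rep _ 1 0 0 ?_).trans ?_ <;> norm_num [fVec, gVec]
      · refine (jc_rep _ 1 0 0 ?_).trans ?_ <;> norm_num [fVec, gVec]
      · refine (jc_rep _ 5 0 0 ?_).trans ?_ <;> norm_num [fVec, gVec]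
      · refine (jc_rep _ 3 0 0 ?_).trans ?_ <;> norm_num [fVec, gVec]
      · refine (jc_rep _ 4 0 0 ?_).trans ?_ <;> norm_num [fVec, gVec]
      · refine (jc_rep _ 4 0 0 ?_).trans ?_ <;> norm_num [fVec, gVec]
    have h' := h.trans e
    rw [h']
    exact cone_g
  · have h := vec_apply (fun s t => jcCorrect ((s + t) / 2)) fVec gVec
    have e : (fun p => jcCorrect ((fVec p + gVec p) / 2)) = (![(3/4) * (1 * Real.log 2 - 0 * Real.log 3 - 0 * Real.log 11),
      (3/4) * (3 * Real.log 2 - 1 * Real.log 3 - 0 * Real.log 11),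
      (3/4) * (6 * Real.log 2 - 1 * Real.log 3 - 0 * Real.log 11),
      (3/4) * (6 * Real.log 2 - 2 * Real.log 3 - 0 * Real.log 11),
      (3/4) * (5 * Real.log 2 - 2 * Real.log 3 - 0 * Real.log 11),
      (3/4) * (7 * Real.log 2 - 1 * Real.log 3 - 1 * Real.log 11),
      (3/4) * (7 * Real.log 2 - 1 * Real.log 3 - 0 * Real.log 11),
      (3/4) * (5 * Real.log 2 - 1 * Real.log 3 - 0 * Real.log 11),
      (3/4) * (5 * Real.log 2 - 1 * Real.log 3 - 0 * Real.log 11),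
      (3/4) * (6 * Real.log 2 - 1 * Real.log 3 - 0 * Real.log 11)] : Fin 10 → ℝ) := by
      funext p
      fin_cases p
      · refine (jc_rep _ 1 0 0 ?_).trans ?_ <;> norm_num [fVec, gVec]
      · refine (jc_rep _ 3 1 0 ?_).trans ?_ <;> norm_num [fVec, gVec]
      · refine (jc_rep _ 6 1 0 ?_).trans ?_ <;> norm_num [fVec, gVec]
      · refine (jc_rep _ 6 2 0 ?_).trans ?_ <;> norm_num [fVec, gVec]
      · refine (jc_rep _ 5 2 0 ?_).trans ?_ <;> norm_num [fVec, gVec]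
      · refine (jc_rep _ 7 1 1 ?_).trans ?_ <;> norm_num [fVec, gVec]
      · refine (jc_rep _ 7 1 0 ?_).trans ?_ <;> norm_num [fVec, gVec]
      · refine (jc_rep _ 5 1 0 ?_).trans ?_ <;> norm_num [fVec, gVec]
      · refine (jc_rep _ 5 1 0 ?_).trans ?_ <;> norm_num [fVec, gVec]
      · refine (jc_rep _ 6 1 0 ?_).trans ?_ <;> norm_num [fVec, gVec]
    have h' := h.trans e
    rw [h']
    exact cone_fg
end
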